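/- arXiv:math/0106165 — 6 statements merged into one kernel-verified Lean document; each statement's English description precedes it below -/
import Mathlib

section
/- In the rack chain complex of a rack X, for any chain c ∈ C_n^R(X) and y ∈ X, ∂(c * y) = ∂(c) * y + (−1)^{n+1}(c − c^y), where (x₁,…,xₙ)*y = (x₁,…,xₙ,y) and (x₁,…,xₙ)^y = (x₁^y,…,xₙ^y), extended linearly. -/
/-- A rack: a set with a binary operation `act a b = a^b` such that each
`fun a => a^b` is a bijection and the rack identity `(a^b)^c = (a^c)^(b^c)` holds. -/
structure RackStr (X : Type) where
  act : X → X → X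
  bij : ∀ b, Function.Bijective fun a => act a b
  distrib : ∀ a b c, act (act a b) c = act (act a c) (act b c)

variable {X : Type}

/-- The group of rack `n`-chains: the free abelian group on `Xⁿ`. -/
abbrev Ch (X : Type) (n : ℕ) := FreeAbelianGroup (Fin n → X)

/-- Face map `∂_i^0`: delete the `i`-th entry. -/
def face0 {n : ℕ} (i : Fin (n + 1)) (x : Fin (n + 1) → X) : Fin n → X :=
  fun j => x (i.succAbove j)

/-- Face map `∂_i^1`: delete the `i`-th entry and act by it on all earlier entries. -/
def face1 (R : RackStr X) {n : ℕ} (i : Fin (n + 1)) (x : Fin (n + 1) → X) : Fin n → X :=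
  fun j => if (j : ℕ) < (i : ℕ) then R.act (x j.castSucc) (x i) else x j.succ

/-- The rack boundary map `∂ = ∑ᵢ (-1)^i (∂_i^0 - ∂_i^1)` (entries indexed from 1
in the paper; here `i : Fin (n+1)` contributes sign `(-1)^(i+1)`). -/
def bdry (R : RackStr X) (n : ℕ) : Ch X (n + 1) →+ Ch X n :=
  FreeAbelianGroup.lift fun x =>
    ∑ i : Fin (n + 1), ((-1 : ℤ) ^ ((i : ℕ) + 1)) •
      (FreeAbelianGroup.of (face0 i x) - FreeAbelianGroup.of (face1 R i x))

/-- `c * y`: append `y` to each tuple, extended linearly. -/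
def star (n : ℕ) (y : X) : Ch X n →+ Ch X (n + 1) :=
  FreeAbelianGroup.lift fun x => FreeAbelianGroup.of (Fin.snoc x y)

/-- `c^y`: act by `y` on every entry, extended linearly. -/
def powy (R : RackStr X) (n : ℕ) (y : X) : Ch X n →+ Ch X n :=
  FreeAbelianGroup.lift fun x => FreeAbelianGroup.of fun i => R.act (x i) y

theorem face0_snoc_last {n : ℕ} (x : Fin (n + 1) → X) (y : X) :
    face0 (Fin.last (n + 1)) (Fin.snoc x y : Fin (n + 2) → X) = x := by
  funext j
  simp [face0]

theorem face1_snoc_last (R : RackStr X) {n : ℕ} (x : Fin (n + 1) → X) (y : X) :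
    face1 R (Fin.last (n + 1)) (Fin.snoc x y : Fin (n + 2) → X) = fun i => R.act (x i) y := by
  funext j
  have h : (j : ℕ) < n + 1 := j.2
  simp [face1, h]

theorem face0_snoc_castSucc {n : ℕ} (i : Fin (n + 1)) (x : Fin (n + 1) → X) (y : X) :
    face0 i.castSucc (Fin.snoc x y : Fin (n + 2) → X) = Fin.snoc (face0 i x) y := by
  funext j
  induction j using Fin.lastCases with
  | last => simp [face0]
  | cast j => simp [face0, Fin.castSucc_succAbove_castSucc]

theorem face1_snoc_castSucc (R : RackStr X) {n : ℕ} (i : Fin (n + 1)) (x : Fin (n + 1) → X)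
    (y : X) :
    face1 R i.castSucc (Fin.snoc x y : Fin (n + 2) → X) = Fin.snoc (face1 R i x) y := by
  funext j
  induction j using Fin.lastCases with
  | last =>
    have h : ¬ (n < (i : ℕ)) := by have := i.2; omega
    simp [face1, h]
  | cast j =>
    simp only [face1, Fin.snoc_castSucc, Fin.val_castSucc, Fin.succ_castSucc]

theorem stmt9 (R : RackStr X) (n : ℕ) (c : Ch X (n + 1)) (y : X) :
    bdry R (n + 1) (star (n + 1) y c) =
      star n y (bdry R n c) + ((-1 : ℤ) ^ (n + 2)) • (c - powy R (n + 1) y c) := by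
  induction c using FreeAbelianGroup.induction_on with
  | zero => simp
  | of x =>
    simp only [bdry, _root_.star, powy, FreeAbelianGroup.lift_apply_of, map_sum, map_zsmul, map_sub]
    rw [Fin.sum_univ_castSucc]
    simp only [face0_snoc_last, face1_snoc_last, face0_snoc_castSucc, face1_snoc_castSucc,
      Fin.val_castSucc, Fin.val_last]
  | neg x ih =>
    simp only [map_neg, ih]
    rw [neg_add, ← smul_neg, neg_sub, neg_sub_neg]
  | add a b iha ihb =>
    simp only [map_add, iha, ihb]
    rw [add_sub_add_comm, smul_add]
    abel
end

section
/- For a quandle X and the chain map α defined by α₁ = id, α_{n+1}(x*y) = αₙ(x)*y − αₙ(x)*xₙ: (a) αₙ vanishes on the degenerate subgroup C_n^D(X); (b) for every c ∈ C_n^R(X), c − αₙ(c) ∈ C_n^D(X). Hence c ↦ c − α(c) is a chain projection of C_*^R(X) onto C_*^D(X), and the short exact sequence 0 → C_*^D(X) → C_*^R(X) → C_*^Q(X) → 0 splits. -/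
variable {X : Type}

/-- The maps `αₙ`: `α₁ = id` and `α_{n+1}(x * y) = αₙ(x)*y - αₙ(x)*xₙ`. -/
def alpha (R : RackStr X) : (n : ℕ) → Ch X n →+ Ch X n
  | 0 => AddMonoidHom.id _
  | 1 => AddMonoidHom.id _
  | (n + 2) => FreeAbelianGroup.lift fun v =>
      star (n + 1) (v (Fin.last (n + 1)))
          (alpha R (n + 1) (FreeAbelianGroup.of (Fin.init v))) -
        star (n + 1) (Fin.init v (Fin.last n))
          (alpha R (n + 1) (FreeAbelianGroup.of (Fin.init v)))

/-- Degenerate tuples: some two consecutive entries are equal. -/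
def Deg (X : Type) (n : ℕ) : Set (Fin n → X) :=
  {v | ∃ i j : Fin n, (i : ℕ) + 1 = (j : ℕ) ∧ v i = v j}

/-- The degenerate subgroup `C_n^D(X)`. -/
def CD (X : Type) (n : ℕ) : AddSubgroup (Ch X n) :=
  AddSubgroup.closure (FreeAbelianGroup.of '' Deg X n)

/-- Append with non-dependent type. -/
def sn {n : ℕ} (x : Fin n → X) (y : X) : Fin (n + 1) → X := Fin.snoc x y

theorem sn_castSucc {n : ℕ} (x : Fin n → X) (y : X) (i : Fin n) : sn x y i.castSucc = x i := by
  simp [sn]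

theorem sn_last {n : ℕ} (x : Fin n → X) (y : X) : sn x y (Fin.last n) = y := by
  simp [sn]

theorem init_sn {n : ℕ} (x : Fin n → X) (y : X) :
    (Fin.init (sn x y) : Fin n → X) = x := by
  funext i; exact sn_castSucc x y i

theorem sn_surj {n : ℕ} (v : Fin (n + 1) → X) : ∃ x y, v = sn (n := n) x y :=
  ⟨Fin.init v, v (Fin.last n), (Fin.snoc_init_self v).symm⟩

theorem sn_ext {n : ℕ} {v : Fin (n + 1) → X} {x : Fin n → X} {y : X}
    (h1 : ∀ i : Fin n, v i.castSucc = x i) (h2 : v (Fin.last n) = y) : v = sn x y := by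
  funext i
  induction i using Fin.lastCases with
  | last => rw [sn_last, h2]
  | cast i => rw [sn_castSucc, h1]

theorem star_of {n : ℕ} (x : Fin n → X) (y : X) :
    star n y (FreeAbelianGroup.of x) = FreeAbelianGroup.of (sn x y) := by
  rw [_root_.star, FreeAbelianGroup.lift_apply_of, sn]

theorem powy_of (R : RackStr X) {n : ℕ} (x : Fin n → X) (y : X) :
    powy R n y (FreeAbelianGroup.of x) = FreeAbelianGroup.of fun i => R.act (x i) y := by
  simp [powy]

theorem alpha_sn (R : RackStr X) {n : ℕ} (x : Fin (n + 1) → X) (y : X) :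
    alpha R (n + 2) (FreeAbelianGroup.of (sn x y)) =
      star (n + 1) y (alpha R (n + 1) (FreeAbelianGroup.of x)) -
      star (n + 1) (x (Fin.last n)) (alpha R (n + 1) (FreeAbelianGroup.of x)) := by
  rw [alpha, FreeAbelianGroup.lift_apply_of, sn_last, init_sn]

theorem hom_ext {n : ℕ} {G : Type} [AddCommGroup G] {f g : Ch X n →+ G}
    (h : ∀ x, f (FreeAbelianGroup.of x) = g (FreeAbelianGroup.of x)) (c : Ch X n) : f c = g c := by
  have : f = g := FreeAbelianGroup.lift_ext _ _ h
  rw [this]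

theorem powy_star (R : RackStr X) {n : ℕ} (z y : X) (c : Ch X n) :
    powy R (n + 1) y (star n z c) = star n (R.act z y) (powy R n y c) := by
  refine hom_ext (f := (powy R (n + 1) y).comp (star n z))
    (g := (star n (R.act z y)).comp (powy R n y)) (fun x => ?_) c
  simp only [AddMonoidHom.comp_apply]
  rw [star_of, powy_of, powy_of, star_of]
  congr 1
  apply sn_ext
  · intro i; rw [sn_castSucc]
  · rw [sn_last]

theorem pow_sn (R : RackStr X) {n : ℕ} (x : Fin n → X) (z y : X) :
    (fun i => R.act (sn x z i) y) = sn (fun i => R.act (x i) y) (R.act z y) := by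
  apply sn_ext
  · intro i; rw [sn_castSucc]
  · rw [sn_last]

theorem alpha_powy_of (R : RackStr X) (y : X) : ∀ (n : ℕ) (x : Fin n → X),
    alpha R n (FreeAbelianGroup.of fun i => R.act (x i) y) =
      powy R n y (alpha R n (FreeAbelianGroup.of x))
  | 0, x => by simp [alpha, powy_of]
  | 1, x => by simp [alpha, powy_of]
  | n + 2, x => by
    obtain ⟨x, z, rfl⟩ := sn_surj x
    rw [pow_sn, alpha_sn, alpha_sn, map_sub, powy_star, powy_star, alpha_powy_of R y (n + 1) x]

theorem alpha_powy (R : RackStr X) (y : X) (n : ℕ) (c : Ch X n) :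
    alpha R n (powy R n y c) = powy R n y (alpha R n c) := by
  refine hom_ext (f := (alpha R n).comp (powy R n y))
    (g := (powy R n y).comp (alpha R n)) (fun x => ?_) c
  simp only [AddMonoidHom.comp_apply]
  rw [powy_of, alpha_powy_of]

theorem alpha_star_star (R : RackStr X) {n : ℕ} (l y : X) (c : Ch X n) :
    alpha R (n + 2) (star (n + 1) y (star n l c)) =
      star (n + 1) y (alpha R (n + 1) (star n l c)) -
      star (n + 1) l (alpha R (n + 1) (star n l c)) := by
  refine hom_ext (f := (alpha R (n + 2)).comp ((star (n + 1) y).comp (star n l)))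
    (g := (star (n + 1) y).comp ((alpha R (n + 1)).comp (star n l)) -
      (star (n + 1) l).comp ((alpha R (n + 1)).comp (star n l))) (fun x => ?_) c
  simp only [AddMonoidHom.comp_apply, AddMonoidHom.sub_apply]
  rw [star_of, star_of, alpha_sn, sn_last]

theorem face0_cast {n : ℕ} (i : Fin (n + 1)) (x : Fin (n + 1) → X) (y : X) :
    face0 i.castSucc (sn x y) = sn (face0 i x) y := by
  apply sn_ext
  · intro j
    simp only [face0]
    rw [← sn_castSucc x y]
    congr 1
    exact (Fin.castSucc_succAbove_castSucc)
  · simp only [face0]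
    rw [show (i.castSucc).succAbove (Fin.last n) = Fin.last (n + 1) from by
      rw [Fin.succAbove_of_le_castSucc _ _ (by rw [Fin.castSucc_le_castSucc_iff]; exact Fin.le_last i), Fin.succ_last], sn_last]

theorem face0_last {n : ℕ} (x : Fin n → X) (y : X) :
    face0 (Fin.last n) (sn x y) = x := by
  funext j
  simp only [face0]
  rw [Fin.succAbove_last, sn_castSucc]

theorem face1_cast (R : RackStr X) {n : ℕ} (i : Fin (n + 1)) (x : Fin (n + 1) → X) (y : X) :
    face1 R i.castSucc (sn x y) = sn (face1 R i x) y := by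
  apply sn_ext
  · intro j
    simp only [face1]
    rw [Fin.succ_castSucc, sn_castSucc, sn_castSucc, sn_castSucc]
    rfl
  · have h : ¬ (n < (i : ℕ)) := by omega
    simp only [face1, Fin.val_last, Fin.val_castSucc, h, if_false]
    rw [Fin.succ_last, sn_last]

theorem face1_last (R : RackStr X) {n : ℕ} (x : Fin n → X) (y : X) :
    face1 R (Fin.last n) (sn x y) = fun i => R.act (x i) y := by
  funext j
  simp only [face1, Fin.val_last, j.isLt, if_true]
  rw [sn_castSucc, sn_last]

theorem bdry_star (R : RackStr X) (n : ℕ) (y : X) (c : Ch X (n + 1)) :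
    bdry R (n + 1) (star (n + 1) y c) = star n y (bdry R n c) +
      ((-1 : ℤ) ^ n) • (c - powy R (n + 1) y c) := by
  refine hom_ext (f := (bdry R (n + 1)).comp (star (n + 1) y))
    (g := (star n y).comp (bdry R n) +
      ((-1 : ℤ) ^ n) • (AddMonoidHom.id _ - powy R (n + 1) y)) (fun x => ?_) c
  simp only [AddMonoidHom.comp_apply, AddMonoidHom.add_apply, AddMonoidHom.smul_apply,
    AddMonoidHom.sub_apply, AddMonoidHom.id_apply]
  rw [star_of, bdry, bdry, FreeAbelianGroup.lift_apply_of, FreeAbelianGroup.lift_apply_of,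
    Fin.sum_univ_castSucc, face0_last, face1_last, map_sum, powy_of]
  congr 1
  · apply Finset.sum_congr rfl
    intro i _
    rw [face0_cast, face1_cast, map_zsmul, map_sub, star_of, star_of]
    rfl
  · rw [Fin.val_last]
    congr 1
    ring

theorem bdry_zero' (R : RackStr X) (c : Ch X 1) : bdry R 0 c = 0 := by
  refine hom_ext (f := bdry R 0) (g := 0) (fun x => ?_) c
  rw [bdry, FreeAbelianGroup.lift_apply_of]
  have h : face0 (0 : Fin 1) x = face1 R 0 x := Subsingleton.elim _ _
  simp [h]

theorem chain_of (R : RackStr X) (hq : ∀ a, R.act a a = a) : ∀ (n : ℕ) (v : Fin (n + 1) → X),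
    bdry R n (alpha R (n + 1) (FreeAbelianGroup.of v)) =
      alpha R n (bdry R n (FreeAbelianGroup.of v))
  | 0, v => by simp [alpha]
  | 1, v => by
    obtain ⟨x, y, rfl⟩ := sn_surj v
    have hx : (fun i => R.act (x i) (x (Fin.last 0))) = x := by
      funext i
      rw [Subsingleton.elim i (Fin.last 0), hq]
    rw [alpha_sn, map_sub, bdry_star, bdry_star, ← star_of, bdry_star]
    have hx' : powy R (0 + 1) (x (Fin.last 0)) (FreeAbelianGroup.of x) = FreeAbelianGroup.of x := by
      rw [powy_of, hx]
    simp only [alpha, AddMonoidHom.id_apply, bdry_zero', hx', map_zero]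
    simp
  | n + 2, v => by
    obtain ⟨x, y, rfl⟩ := sn_surj v
    have ih := chain_of R hq (n + 1) x
    obtain ⟨w, l, rfl⟩ := sn_surj x
    set p := w (Fin.last n) with hp
    rw [alpha_sn, map_sub, bdry_star, bdry_star, ih, sn_last, ← star_of (sn w l) y, bdry_star, ← star_of w l, bdry_star]
    have hA : alpha R (n + 2) (star (n + 1) l (FreeAbelianGroup.of w)) =
        star (n + 1) l (alpha R (n + 1) (FreeAbelianGroup.of w)) -
        star (n + 1) p (alpha R (n + 1) (FreeAbelianGroup.of w)) := by
      rw [star_of, alpha_sn]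
    have hB : alpha R (n + 2) (star (n + 1) y (FreeAbelianGroup.of w)) =
        star (n + 1) y (alpha R (n + 1) (FreeAbelianGroup.of w)) -
        star (n + 1) p (alpha R (n + 1) (FreeAbelianGroup.of w)) := by
      rw [star_of, alpha_sn]
    have hC : alpha R (n + 2) (star (n + 1) y (powy R (n + 1) l (FreeAbelianGroup.of w))) =
        star (n + 1) y (powy R (n + 1) l (alpha R (n + 1) (FreeAbelianGroup.of w))) -
        star (n + 1) (R.act p l) (powy R (n + 1) l (alpha R (n + 1) (FreeAbelianGroup.of w))) := by
      rw [powy_of, star_of, alpha_sn, alpha_powy_of]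
    have hD : alpha R (n + 2)
          (star (n + 1) (R.act l y) (powy R (n + 1) y (FreeAbelianGroup.of w))) =
        star (n + 1) (R.act l y) (powy R (n + 1) y (alpha R (n + 1) (FreeAbelianGroup.of w))) -
        star (n + 1) (R.act p y)
          (powy R (n + 1) y (alpha R (n + 1) (FreeAbelianGroup.of w))) := by
      rw [← powy_star, alpha_powy, hA, map_sub, powy_star, powy_star]
    simp only [map_add, map_sub, map_zsmul, alpha_star_star, alpha_powy, powy_star, hA, hB, hC, hD, hq]
    rw [pow_succ]
    simp only [mul_neg, mul_one]
    module

theorem chain (R : RackStr X) (hq : ∀ a, R.act a a = a) (n : ℕ) (c : Ch X (n + 1)) :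
    bdry R n (alpha R (n + 1) c) = alpha R n (bdry R n c) :=
  hom_ext (f := (bdry R n).comp (alpha R (n + 1))) (g := (alpha R n).comp (bdry R n))
    (fun x => chain_of R hq n x) c

theorem alpha_deg (R : RackStr X) : ∀ (n : ℕ) (v : Fin n → X), v ∈ Deg X n →
    alpha R n (FreeAbelianGroup.of v) = 0
  | 0, _, ⟨i, _⟩ => i.elim0
  | 1, _, ⟨i, j, h, _⟩ => by omega
  | n + 2, v, ⟨i, j, h, e⟩ => by
    obtain ⟨x, y, rfl⟩ := sn_surj v
    rw [alpha_sn]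
    have hi : i ≠ Fin.last _ := by
      rintro rfl
      rw [Fin.val_last] at h
      omega
    obtain ⟨i, rfl⟩ := Fin.exists_castSucc_eq.2 hi
    induction j using Fin.lastCases with
    | last =>
      have : i = Fin.last n := by
        ext
        simpa using h
      subst this
      rw [sn_castSucc, sn_last] at e
      rw [e, sub_self]
    | cast j =>
      rw [sn_castSucc, sn_castSucc] at e
      rw [alpha_deg R (n + 1) x ⟨i, j, h, e⟩]
      simp

theorem star_CD {n : ℕ} (y : X) {c : Ch X n} (hc : c ∈ CD X n) : star n y c ∈ CD X (n + 1) := by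
  have : CD X n ≤ (CD X (n + 1)).comap (star n y) := by
    refine (AddSubgroup.closure_le _).2 ?_
    rintro _ ⟨v, ⟨i, j, h, e⟩, rfl⟩
    show star n y _ ∈ CD X (n + 1)
    rw [star_of]
    exact AddSubgroup.subset_closure ⟨_, ⟨i.castSucc, j.castSucc, h, by
      rw [sn_castSucc, sn_castSucc, e]⟩, rfl⟩
  exact this hc

theorem sub_alpha_of (R : RackStr X) : ∀ (n : ℕ) (v : Fin n → X),
    FreeAbelianGroup.of v - alpha R n (FreeAbelianGroup.of v) ∈ CD X n
  | 0, v => by simp [alpha, zero_mem]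
  | 1, v => by simp [alpha, zero_mem]
  | n + 2, v => by
    obtain ⟨x, y, rfl⟩ := sn_surj v
    have ih := sub_alpha_of R (n + 1) x
    have h1 := star_CD y ih
    have h2 := star_CD (x (Fin.last n)) ih
    have h3 : star (n + 1) (x (Fin.last n)) (FreeAbelianGroup.of x) ∈ CD X (n + 2) := by
      rw [star_of]
      refine AddSubgroup.subset_closure ⟨_, ⟨(Fin.last n).castSucc, Fin.last (n + 1), ?_, ?_⟩, rfl⟩
      · simp
      · rw [sn_castSucc, sn_last]
    have h4 := add_mem (sub_mem h1 h2) h3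
    rw [alpha_sn, ← star_of]
    convert h4 using 1
    simp only [map_sub]
    abel

/-- (a) `α` vanishes on `C^D`; (b) `c - α c ∈ C^D`; hence `c ↦ c - α c` is a
chain projection of `C^R` onto `C^D`, splitting `0 → C^D → C^R → C^Q → 0`. -/
theorem stmt11 (R : RackStr X) (hq : ∀ a, R.act a a = a) :
    (∀ (n : ℕ) (c : Ch X n), c ∈ CD X n → alpha R n c = 0) ∧
    (∀ (n : ℕ) (c : Ch X n), c - alpha R n c ∈ CD X n) ∧
    (∀ (n : ℕ) (c : Ch X (n + 1)),
      bdry R n (c - alpha R (n + 1) c) = bdry R n c - alpha R n (bdry R n c)) := by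
  refine ⟨fun n c hc => ?_, fun n c => ?_, fun n c => ?_⟩
  · have : CD X n ≤ (alpha R n).ker := by
      refine (AddSubgroup.closure_le _).2 ?_
      rintro _ ⟨v, hv, rfl⟩
      exact alpha_deg R n v hv
    exact this hc
  · have := hom_ext (f := (QuotientAddGroup.mk' (CD X n)).comp
      (AddMonoidHom.id _ - alpha R n)) (g := 0) (fun x => by
        exact (QuotientAddGroup.eq_zero_iff _).2 (sub_alpha_of R n x)) c
    exact (QuotientAddGroup.eq_zero_iff _).1 this
  · rw [map_sub, chain R hq]
end

section
/- For a quandle X, the subgroups C_n^L(X) of C_n^D(X) generated by tuples (x₁,…,xₙ) with x_i = x_{i+1} for some i with 2 ≤ i < n form a subcomplex: ∂(C_n^L(X)) ⊆ C_{n−1}^L(X). -/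
variable {X : Type}

/-- Late-degenerate tuples: `v i = v (i+1)` for some `i ≥ 2` (paper's 1-based
indexing), i.e. `i ≥ 1` in 0-based indexing. -/
def LDeg (X : Type) (n : ℕ) : Set (Fin n → X) :=
  {v | ∃ i j : Fin n, 1 ≤ (i : ℕ) ∧ (i : ℕ) + 1 = (j : ℕ) ∧ v i = v j}

/-- The subgroup `C_n^L(X)` of `C_n^D(X)`. -/
def CL (X : Type) (n : ℕ) : AddSubgroup (Ch X n) :=
  AddSubgroup.closure (FreeAbelianGroup.of '' LDeg X n)

theorem face0_apply {n : ℕ} (i : Fin (n + 1)) (x : Fin (n + 1) → X) (j : Fin n) :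
    face0 i x j = if (j : ℕ) < (i : ℕ) then x j.castSucc else x j.succ := by
  unfold face0 Fin.succAbove
  simp only [Fin.lt_def, Fin.val_castSucc]
  split_ifs <;> rfl

theorem face_zero_eq (R : RackStr X) {n : ℕ} (k : Fin (n + 1)) (hk : (k : ℕ) = 0)
    (x : Fin (n + 1) → X) : face0 k x = face1 R k x := by
  funext j
  simp [face0_apply, face1, hk]

theorem face_mem (R : RackStr X) {n : ℕ} (k i j : Fin (n + 1)) (x : Fin (n + 1) → X)
    (hi : 1 ≤ (i : ℕ)) (hij : (i : ℕ) + 1 = (j : ℕ)) (hx : x i = x j)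
    (hki : k ≠ i) (hkj : k ≠ j) (hk : (k : ℕ) ≠ 0) :
    face0 k x ∈ LDeg X n ∧ face1 R k x ∈ LDeg X n := by
  have hki' : (k : ℕ) ≠ i := fun h => hki (Fin.ext h)
  have hkj' : (k : ℕ) ≠ j := fun h => hkj (Fin.ext h)
  have h1 := i.isLt
  have h2 := j.isLt
  have h3 := k.isLt
  rcases lt_or_gt_of_ne hki' with h | h
  · have e1 : (⟨(i : ℕ) - 1, by omega⟩ : Fin n).succ = i := Fin.ext (by simp; omega)
    have e2 : (⟨(i : ℕ), by omega⟩ : Fin n).succ = j := Fin.ext (by simp; omega)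
    have n1 : ¬ ((i : ℕ) - 1 < k) := by omega
    have n2 : ¬ ((i : ℕ) < k) := by omega
    constructor <;> refine ⟨⟨(i : ℕ) - 1, by omega⟩, ⟨(i : ℕ), by omega⟩, by simp; omega,
      by simp; omega, ?_⟩
    · rw [face0_apply, face0_apply, e1, e2, if_neg n1, if_neg n2, hx]
    · unfold face1
      rw [e1, e2, if_neg n1, if_neg n2, hx]
  · have e1 : (⟨(i : ℕ), by omega⟩ : Fin n).castSucc = i := rfl
    have e2 : (⟨(j : ℕ), by omega⟩ : Fin n).castSucc = j := rfl
    have n1 : (i : ℕ) < k := by omega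
    have n2 : (j : ℕ) < k := by omega
    constructor <;> refine ⟨⟨(i : ℕ), by omega⟩, ⟨(j : ℕ), by omega⟩, hi, hij, ?_⟩
    · rw [face0_apply, face0_apply, e1, e2, if_pos n1, if_pos n2, hx]
    · unfold face1
      rw [e1, e2, if_pos n1, if_pos n2, hx]

theorem face_eq (R : RackStr X) (hq : ∀ a, R.act a a = a) {n : ℕ} (i j : Fin (n + 1))
    (x : Fin (n + 1) → X) (hij : (i : ℕ) + 1 = (j : ℕ)) (hx : x i = x j) :
    face0 i x = face0 j x ∧ face1 R i x = face1 R j x := by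
  constructor <;> funext m <;> simp only [face0_apply, face1] <;>
    rcases lt_trichotomy (m : ℕ) i with h | h | h
  · rw [if_pos h, if_pos (by omega)]
  · have e1 : m.castSucc = i := Fin.ext h
    have e2 : m.succ = j := Fin.ext (by simp; omega)
    rw [if_neg (by omega), if_pos (by omega), e1, e2, hx]
  · rw [if_neg (by omega), if_neg (by omega)]
  · rw [if_pos h, if_pos (by omega), hx]
  · have e1 : m.castSucc = i := Fin.ext h
    have e2 : m.succ = j := Fin.ext (by simp; omega)
    rw [if_neg (by omega), if_pos (by omega), e1, e2, hx, hq]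
  · rw [if_neg (by omega), if_neg (by omega)]

/-- The subgroups `C_n^L(X)` form a subcomplex. -/
theorem stmt12 (R : RackStr X) (hq : ∀ a, R.act a a = a) (n : ℕ)
    (c : Ch X (n + 1)) (hc : c ∈ CL X (n + 1)) :
    bdry R n c ∈ CL X n := by
  have key : CL X (n + 1) ≤ (CL X n).comap (bdry R n) := by
    unfold CL
    rw [AddSubgroup.closure_le]
    rintro _ ⟨x, ⟨i, j, hi, hij, hx⟩, rfl⟩
    change bdry R n (FreeAbelianGroup.of x) ∈ CL X n
    unfold bdry
    rw [FreeAbelianGroup.lift_apply_of]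
    have hne : j ≠ i := fun h => by rw [h] at hij; omega
    rw [← Finset.add_sum_erase _ _ (Finset.mem_univ i),
      ← Finset.add_sum_erase _ _ (Finset.mem_erase.2 ⟨hne, Finset.mem_univ j⟩), ← add_assoc]
    obtain ⟨h0, h1⟩ := face_eq R hq i j x hij hx
    refine add_mem ?_ (sum_mem fun k hk => ?_)
    · rw [h0, h1, ← hij, ← add_smul, pow_succ _ ((i : ℕ) + 1)]
      simp
    · simp only [Finset.mem_erase, Finset.mem_univ, and_true] at hk
      apply zsmul_mem
      by_cases hk0 : (k : ℕ) = 0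
      · rw [face_zero_eq R k hk0, sub_self]
        exact zero_mem _
      · obtain ⟨a, b⟩ := face_mem R k i j x hi hij hx hk.2 hk.1 hk0
        exact sub_mem (AddSubgroup.subset_closure ⟨_, a, rfl⟩)
          (AddSubgroup.subset_closure ⟨_, b, rfl⟩)
  exact key hc
end

section
/- For a quandle X, there is an isomorphism of chain complexes C_*^D(X) ≅ C_{*−1}^Q(X) ⊕ C_*^L(X). -/
variable {X : Type}

/-- The quandle chain group `C_n^Q(X) = C_n^R(X)/C_n^D(X)`. -/
abbrev ChQ (X : Type) (n : ℕ) := Ch X n ⧸ CD X n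


namespace S14

open FreeAbelianGroup

lemma star_of (n : ℕ) (y : X) (w : Fin n → X) :
    star n y (of w) = of (Fin.snoc w y : Fin (n + 1) → X) := by simp [_root_.star]

lemma powy_of (R : RackStr X) (n : ℕ) (y : X) (w : Fin n → X) :
    powy R n y (of w) = of (fun i => R.act (w i) y) := by simp [powy]

lemma bdry_of (R : RackStr X) (n : ℕ) (x : Fin (n + 1) → X) :
    bdry R n (of x) = ∑ i : Fin (n + 1), ((-1 : ℤ) ^ ((i : ℕ) + 1)) •
      (of (face0 i x) - of (face1 R i x)) := by simp [bdry]

/-- `∂c * y`, zero in degree 0. -/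
def bstar (R : RackStr X) : (n : ℕ) → X → (Ch X n →+ Ch X n)
  | 0, _ => 0
  | m + 1, y => (star m y).comp (bdry R m)

lemma face0_snoc {n : ℕ} (i : Fin (n + 1)) (w : Fin (n + 1) → X) (y : X) :
    face0 i.castSucc (Fin.snoc w y : Fin (n + 2) → X)
      = (Fin.snoc (face0 i w) y : Fin (n + 1) → X) := by
  funext j
  refine Fin.lastCases ?_ (fun j => ?_) j
  · simp [face0]
  · simp only [face0, Fin.snoc_castSucc, Fin.castSucc_succAbove_castSucc]

lemma face1_snoc (R : RackStr X) {n : ℕ} (i : Fin (n + 1)) (w : Fin (n + 1) → X) (y : X) :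
    face1 R i.castSucc (Fin.snoc w y : Fin (n + 2) → X)
      = (Fin.snoc (face1 R i w) y : Fin (n + 1) → X) := by
  funext j
  refine Fin.lastCases ?_ (fun j => ?_) j
  · have : ¬ (n < (i : ℕ)) := by omega
    simp [face1, this]
  · simp only [face1, Fin.snoc_castSucc, Fin.val_castSucc, Fin.succ_castSucc]

lemma face0_last {n : ℕ} (w : Fin n → X) (y : X) :
    face0 (Fin.last n) (Fin.snoc w y : Fin (n + 1) → X) = w := by
  funext j
  simp [face0]

lemma face1_last (R : RackStr X) {n : ℕ} (w : Fin n → X) (y : X) :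
    face1 R (Fin.last n) (Fin.snoc w y : Fin (n + 1) → X) = fun j => R.act (w j) y := by
  funext j
  simp [face1]

lemma bdry_star (R : RackStr X) (n : ℕ) (y : X) (c : Ch X n) :
    bdry R n (star n y c) = bstar R n y c + ((-1 : ℤ) ^ (n + 1)) • (c - powy R n y c) := by
  have : (bdry R n).comp (star n y) = bstar R n y +
      ((-1 : ℤ) ^ (n + 1)) • (AddMonoidHom.id _ - powy R n y) := by
    apply FreeAbelianGroup.lift_ext
    intro w
    simp only [AddMonoidHom.comp_apply, AddMonoidHom.add_apply, AddMonoidHom.smul_apply,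
      AddMonoidHom.sub_apply, AddMonoidHom.id_apply]
    rw [star_of, bdry_of, Fin.sum_univ_castSucc, face0_last, face1_last, powy_of]
    congr 1
    cases n with
    | zero => simp [bstar]
    | succ n =>
      simp only [bstar, AddMonoidHom.comp_apply, bdry_of, map_sum, map_zsmul, map_sub, star_of,
        face0_snoc, face1_snoc, Fin.val_castSucc]
  exact DFunLike.congr_fun this c

/-- Splitting map on tuples. -/
noncomputable def al : (n : ℕ) → (Fin n → X) → Ch X n
  | 0, x => of x
  | 1, x => of x
  | n + 2, x => star (n + 1) (x (Fin.last (n + 1))) (al (n + 1) (Fin.init x))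
      - star (n + 1) (x (Fin.last n).castSucc) (al (n + 1) (Fin.init x))

/-- Splitting map. -/
noncomputable def alpha (n : ℕ) : Ch X n →+ Ch X n := FreeAbelianGroup.lift (al n)

/-- `α(w) * last w`. -/
noncomputable def be : (n : ℕ) → (Fin n → X) → Ch X (n + 1)
  | 0, _ => 0
  | n + 1, x => star (n + 1) (x (Fin.last n)) (al (n + 1) x)

noncomputable def beta (n : ℕ) : Ch X n →+ Ch X (n + 1) := FreeAbelianGroup.lift (be n)

lemma alpha_of (n : ℕ) (x : Fin n → X) : alpha n (of x) = al n x := by simp [alpha]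
lemma beta_of (n : ℕ) (x : Fin n → X) : beta n (of x) = be n x := by simp [beta]

lemma al_snoc (n : ℕ) (w : Fin n → X) (y : X) :
    al (n + 1) (Fin.snoc w y : Fin (n + 1) → X) = star n y (al n w) - be n w := by
  cases n with
  | zero => simp [al, be, star_of]
  | succ n =>
    simp only [al, be, Fin.snoc_last, Fin.init_snoc, Fin.snoc_castSucc]

lemma be_snoc (n : ℕ) (w : Fin n → X) (y : X) :
    be (n + 1) (Fin.snoc w y : Fin (n + 1) → X)
      = star (n + 1) y (al (n + 1) (Fin.snoc w y : Fin (n + 1) → X)) := by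
  simp [be]

lemma alpha_star (n : ℕ) (y : X) (c : Ch X n) :
    alpha (n + 1) (star n y c) = star n y (alpha n c) - beta n c := by
  have : (alpha (n + 1)).comp (star n y) = (star n y).comp (alpha n) - beta n := by
    apply FreeAbelianGroup.lift_ext
    intro w
    simp [star_of, alpha_of, beta_of, al_snoc]
  exact DFunLike.congr_fun this c

lemma beta_star (n : ℕ) (y : X) (c : Ch X n) :
    beta (n + 1) (star n y c) = star (n + 1) y (alpha (n + 1) (star n y c)) := by
  have : (beta (n + 1)).comp (star n y)
      = (star (n + 1) y).comp ((alpha (n + 1)).comp (star n y)) := by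
    apply FreeAbelianGroup.lift_ext
    intro w
    simp [star_of, alpha_of, beta_of, be_snoc]
  exact DFunLike.congr_fun this c

lemma beta_bstar (R : RackStr X) (n : ℕ) (y : X) (c : Ch X n) :
    beta n (bstar R n y c) = star n y (alpha n (bstar R n y c)) := by
  cases n with
  | zero => simp [bstar]
  | succ n => simp [bstar, beta_star]

lemma snoc_ind {n : ℕ} {P : (Fin (n + 1) → X) → Prop}
    (h : ∀ (w : Fin n → X) y, P (Fin.snoc w y : Fin (n + 1) → X)) (x) : P x := by
  rw [← Fin.snoc_init_self x]; exact h _ _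

lemma act_snoc (R : RackStr X) {n : ℕ} (w : Fin n → X) (y z : X) :
    (fun i => R.act ((Fin.snoc w y : Fin (n + 1) → X) i) z)
      = (Fin.snoc (fun i => R.act (w i) z) (R.act y z) : Fin (n + 1) → X) := by
  funext j
  refine Fin.lastCases ?_ (fun j => ?_) j <;> simp

lemma powy_star (R : RackStr X) (n : ℕ) (y z : X) (c : Ch X n) :
    powy R (n + 1) z (star n y c) = star n (R.act y z) (powy R n z c) := by
  have : (powy R (n + 1) z).comp (star n y) = (star n (R.act y z)).comp (powy R n z) := by
    apply FreeAbelianGroup.lift_ext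
    intro w
    simp only [AddMonoidHom.comp_apply, star_of, powy_of, act_snoc]
  exact DFunLike.congr_fun this c

lemma powy_al (R : RackStr X) (z : X) (n : ℕ) (x : Fin n → X) :
    powy R n z (al n x) = al n (fun i => R.act (x i) z) ∧
    powy R (n + 1) z (be n x) = be n (fun i => R.act (x i) z) := by
  induction n with
  | zero => simp [al, be, powy_of]
  | succ n ih =>
    induction x using snoc_ind with
    | h w y =>
    have h1 : powy R (n + 1) z (al (n + 1) (Fin.snoc w y : Fin (n + 1) → X))
        = al (n + 1) (fun i => R.act ((Fin.snoc w y : Fin (n + 1) → X) i) z) := by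
      rw [act_snoc, al_snoc, al_snoc, map_sub, powy_star, (ih w).1, (ih w).2]
    refine ⟨h1, ?_⟩
    rw [be_snoc, powy_star, h1, act_snoc, be_snoc]

lemma bdry_zero (R : RackStr X) (c : Ch X 1) : bdry R 0 c = 0 := by
  have : bdry R 0 = 0 := by
    apply FreeAbelianGroup.lift_ext
    intro w
    rw [bdry_of]
    simp only [Fin.sum_univ_succ, Finset.univ_eq_empty, Finset.sum_empty, AddMonoidHom.zero_apply]
    rw [Subsingleton.elim (face0 0 w) (face1 R 0 w)]
    simp
  rw [this]; rfl

/-- `α` is a chain map. -/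
lemma bdry_al (R : RackStr X) (hq : ∀ a, R.act a a = a) (n : ℕ) (x : Fin (n + 1) → X) :
    bdry R n (al (n + 1) x) = alpha n (bdry R n (of x)) := by
  induction n with
  | zero => rw [bdry_zero, bdry_zero, map_zero]
  | succ n ih =>
    induction x using snoc_ind with
    | h w y =>
    have hw := ih w
    induction w using snoc_ind with
    | h v u =>
    have e1 : be (n + 1) (Fin.snoc v u : Fin (n + 1) → X) = star (n + 1) u (al (n + 1) (Fin.snoc v u : Fin (n + 1) → X)) := be_snoc _ _ _
    have ha : powy R (n + 1) u (al (n + 1) (Fin.snoc v u : Fin (n + 1) → X))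
      = star n u (powy R n u (al n v)) - be n (fun i => R.act (v i) u) := by
      rw [al_snoc, map_sub, powy_star, hq, (powy_al R u n v).2]
    have hy : powy R (n + 1) y (al (n + 1) (Fin.snoc v u : Fin (n + 1) → X))
      = alpha (n + 1) (powy R (n + 1) y (of (Fin.snoc v u : Fin (n + 1) → X))) := by
      rw [powy_of, alpha_of, (powy_al R y (n + 1) _).1]
    have hbw : bdry R n (of (Fin.snoc v u : Fin (n + 1) → X)) = bstar R n u (of v)
        + ((-1 : ℤ) ^ (n + 1)) • (of v - powy R n u (of v)) := by
      rw [← star_of, bdry_star]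
    have hv : alpha n (powy R n u (of v)) = powy R n u (al n v) := by
      rw [powy_of, alpha_of, (powy_al R u n v).1]
    have hb : beta n (powy R n u (of v)) = be n (fun i => R.act (v i) u) := by
      rw [powy_of, beta_of]
    have hp : ((-1 : ℤ) ^ (n + 1 + 1)) = - (-1 : ℤ) ^ (n + 1) := by ring
    rw [al_snoc, e1, map_sub, bdry_star, bdry_star, ← star_of, bdry_star, hy, ha]
    simp only [bstar, AddMonoidHom.comp_apply, hw, star_of]
    simp only [hbw]
    simp only [map_add, map_sub, map_zsmul, alpha_star,
      alpha_of, beta_of, beta_bstar, hv, hb, hp, al_snoc]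
    generalize ((-1 : ℤ) ^ (n + 1)) = ε
    module

lemma bdry_alpha (R : RackStr X) (hq : ∀ a, R.act a a = a) (n : ℕ) (c : Ch X (n + 1)) :
    bdry R n (alpha (n + 1) c) = alpha n (bdry R n c) := by
  have : (bdry R n).comp (alpha (n + 1)) = (alpha n).comp (bdry R n) := by
    apply FreeAbelianGroup.lift_ext
    intro w
    simp only [AddMonoidHom.comp_apply]
    rw [alpha_of, bdry_al R hq]
  exact DFunLike.congr_fun this c

/-- Degenerate from position `k` on. -/
def DegP (X : Type) (k n : ℕ) : Set (Fin n → X) :=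
  {v | ∃ i j : Fin n, k ≤ (i : ℕ) ∧ (i : ℕ) + 1 = (j : ℕ) ∧ v i = v j}

def CP (X : Type) (k n : ℕ) : AddSubgroup (Ch X n) :=
  AddSubgroup.closure (FreeAbelianGroup.of '' DegP X k n)

lemma CD_eq (n : ℕ) : CD X n = CP X 0 n := by
  simp [CD, CP, Deg, DegP]

lemma CL_eq (n : ℕ) : CL X n = CP X 1 n := rfl

lemma of_mem {k n : ℕ} {x : Fin n → X} (h : x ∈ DegP X k n) : of x ∈ CP X k n :=
  AddSubgroup.subset_closure ⟨x, h, rfl⟩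

lemma CP_map {k l n m : ℕ} (f : Ch X n →+ Ch X m)
    (h : ∀ x ∈ DegP X k n, f (of x) ∈ CP X l m) {c : Ch X n} (hc : c ∈ CP X k n) :
    f c ∈ CP X l m := by
  have : CP X k n ≤ (CP X l m).comap f := by
    rw [CP, AddSubgroup.closure_le]
    rintro _ ⟨x, hx, rfl⟩
    exact h x hx
  exact this hc

lemma map_all {n m : ℕ} (S : AddSubgroup (Ch X m)) (f : Ch X n →+ Ch X m)
    (h : ∀ x, f (of x) ∈ S) (c : Ch X n) : f c ∈ S := by
  induction c using FreeAbelianGroup.induction_on with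
  | zero => simp
  | of x => exact h x
  | neg x hx => rw [map_neg]; exact S.neg_mem hx
  | add x y hx hy => rw [map_add]; exact S.add_mem hx hy

lemma deg_snoc {k n : ℕ} {w : Fin n → X} (y : X) (h : w ∈ DegP X k n) :
    (Fin.snoc w y : Fin (n + 1) → X) ∈ DegP X k (n + 1) := by
  obtain ⟨i, j, hi, hij, e⟩ := h
  exact ⟨i.castSucc, j.castSucc, by simpa, by simpa, by simpa⟩

lemma deg_snoc2 {k n : ℕ} (w : Fin n → X) (y : X) (h : k ≤ n) :
    (Fin.snoc (Fin.snoc w y : Fin (n + 1) → X) y : Fin (n + 2) → X) ∈ DegP X k (n + 2) :=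
  ⟨(Fin.last n).castSucc, Fin.last (n + 1), by simpa, by simp, by simp⟩

lemma deg_cases {k n : ℕ} {w : Fin n → X} {y : X}
    (h : (Fin.snoc w y : Fin (n + 1) → X) ∈ DegP X k (n + 1)) :
    w ∈ DegP X k n ∨ ∃ (m : ℕ) (v : Fin m → X) (e : n = m + 1), k ≤ m ∧
      w = (Fin.snoc v y : Fin (m + 1) → X) ∘ Fin.cast e := by
  obtain ⟨i, j, hi, hij, e⟩ := h
  induction j using Fin.lastCases with
  | last =>
    right
    obtain ⟨i, hlt⟩ := i
    simp only [Fin.val_last] at hij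
    subst hij
    refine ⟨i, Fin.init w, rfl, hi, ?_⟩
    have : (⟨i, hlt⟩ : Fin (i + 1 + 1)) = (Fin.last i).castSucc := rfl
    rw [this, Fin.snoc_castSucc, Fin.snoc_last] at e
    rw [← e]
    funext t
    simp
  | cast j =>
    left
    simp only [Fin.val_castSucc] at hij
    have : i = (⟨i, by omega⟩ : Fin n).castSucc := rfl
    rw [this, Fin.snoc_castSucc, Fin.snoc_castSucc] at e
    exact ⟨_, j, hi, hij, e⟩

lemma star_mem {k n : ℕ} (y : X) {c : Ch X n} (h : c ∈ CP X k n) :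
    star n y c ∈ CP X k (n + 1) :=
  CP_map _ (fun x hx => by rw [star_of]; exact of_mem (deg_snoc y hx)) h

lemma powy_deg (R : RackStr X) {k n : ℕ} (y : X) {w : Fin n → X} (h : w ∈ DegP X k n) :
    (fun i => R.act (w i) y) ∈ DegP X k n := by
  obtain ⟨i, j, hi, hij, e⟩ := h
  exact ⟨i, j, hi, hij, by simp [e]⟩

lemma bdry_deg (R : RackStr X) (hq : ∀ a, R.act a a = a) {k : ℕ} (hk : k ≤ 1) (n : ℕ)
    (x : Fin (n + 1) → X) (hx : x ∈ DegP X k (n + 1)) : bdry R n (of x) ∈ CP X k n := by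
  induction n with
  | zero => rw [bdry_zero]; exact zero_mem _
  | succ n ih =>
    induction x using snoc_ind with
    | h w y =>
    rw [← star_of, bdry_star]
    rcases deg_cases hx with h | ⟨m, v, e, hm, rfl⟩
    · refine add_mem (star_mem y (ih w h)) (zsmul_mem (sub_mem (of_mem h) ?_) _)
      rw [powy_of]
      exact of_mem (powy_deg R y h)
    · obtain rfl : n = m := by omega
      have : (Fin.snoc v y : Fin (n + 1) → X) ∘ Fin.cast e = Fin.snoc v y := rfl
      rw [this, ← star_of, powy_star, hq]
      simp only [bstar, AddMonoidHom.comp_apply, bdry_star, map_add, map_zsmul, map_sub]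
      have hp : ((-1 : ℤ) ^ (n + 1 + 1)) = - (-1 : ℤ) ^ (n + 1) := by ring
      rw [hp, neg_smul, add_assoc, add_neg_cancel, add_zero]
      cases n with
      | zero => simp [bstar]
      | succ n =>
        cases n with
        | zero => simp [bstar, bdry_zero]
        | succ n =>
          apply map_all _ ((star _ y).comp (star _ y)) ?_ (bdry R (n + 1) (of v))
          intro x
          simp only [AddMonoidHom.comp_apply, star_of]
          exact of_mem (deg_snoc2 _ _ (by omega))

lemma bdry_mem (R : RackStr X) (hq : ∀ a, R.act a a = a) {k : ℕ} (hk : k ≤ 1) (n : ℕ)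
    {c : Ch X (n + 1)} (h : c ∈ CP X k (n + 1)) : bdry R n c ∈ CP X k n :=
  CP_map _ (bdry_deg R hq hk n) h

lemma al_deg (n : ℕ) (x : Fin n → X) (hx : x ∈ DegP X 0 n) : al n x = 0 := by
  induction n with
  | zero => obtain ⟨i, _⟩ := hx; exact i.elim0
  | succ n ih =>
    induction x using snoc_ind with
    | h w y =>
    rw [al_snoc]
    rcases deg_cases hx with h | ⟨m, v, e, hm, rfl⟩
    · have hw := ih w h
      cases n with
      | zero => simp [hw, be]
      | succ n => rw [be, hw]; simp
    · obtain rfl : n = m + 1 := e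
      have : (Fin.snoc v y : Fin (m + 1) → X) ∘ Fin.cast rfl = Fin.snoc v y := rfl
      rw [this, be_snoc, sub_self]

lemma alpha_deg (n : ℕ) (c : Ch X n) (hc : c ∈ CD X n) : alpha n c = 0 := by
  rw [CD_eq] at hc
  have : CP X 0 n ≤ (alpha n).ker := by
    rw [CP, AddSubgroup.closure_le]
    rintro _ ⟨x, hx, rfl⟩
    change alpha n (of x) = 0
    rw [alpha_of, al_deg n x hx]
  exact this hc

lemma al_sub_mem (n : ℕ) (x : Fin n → X) : al n x - of x ∈ CP X 0 n := by
  induction n with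
  | zero => simp [al]
  | succ n ih =>
    induction x using snoc_ind with
    | h w y =>
    have hw := ih w
    rw [al_snoc, ← star_of, sub_right_comm, ← map_sub]
    refine sub_mem (star_mem y hw) ?_
    cases n with
    | zero => simp [be]
    | succ n =>
      induction w using snoc_ind with
      | h v u =>
      rw [be_snoc, ← sub_add_cancel (al (n + 1) (Fin.snoc v u : Fin (n + 1) → X)) (of (Fin.snoc v u : Fin (n + 1) → X)), map_add]
      refine add_mem (star_mem u hw) ?_
      rw [star_of]
      exact of_mem (deg_snoc2 _ _ (by omega))

lemma alpha_sub_mem (n : ℕ) (c : Ch X n) : alpha n c - c ∈ CD X n := by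
  rw [CD_eq]
  refine map_all (CP X 0 n) (alpha n - AddMonoidHom.id (Ch X n)) ?_ c
  intro x
  simpa [alpha_of] using al_sub_mem n x

/-- Duplicate the first entry. -/
def sd (n : ℕ) : Ch X (n + 1) →+ Ch X (n + 2) :=
  FreeAbelianGroup.lift fun x => of (Fin.cons (x 0) x : Fin (n + 2) → X)

lemma sd_of (n : ℕ) (x : Fin (n + 1) → X) :
    sd n (of x) = of (Fin.cons (x 0) x : Fin (n + 2) → X) := by simp [sd]

lemma bdry_sd (R : RackStr X) (hq : ∀ a, R.act a a = a) (n : ℕ) (c : Ch X (n + 2)) :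
    bdry R (n + 2) (sd (n + 1) c) = - sd n (bdry R (n + 1) c) := by
  have : (bdry R (n + 2)).comp (sd (n + 1)) = - (sd n).comp (bdry R (n + 1)) := by
    apply FreeAbelianGroup.lift_ext
    intro x
    simp only [AddMonoidHom.comp_apply, AddMonoidHom.neg_apply]
    rw [sd_of, bdry_of, Fin.sum_univ_succ, Fin.sum_univ_succ, bdry_of,
      Fin.sum_univ_succ (n := n + 1) (f := fun i : Fin (n + 2) => ((-1 : ℤ) ^ ((i : ℕ) + 1)) •
        (of (face0 i x) - of (face1 R i x)))]
    have h0 : ∀ (m : ℕ) (z : Fin (m + 1) → X), face1 R 0 z = face0 0 z := by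
      intro m z; funext j; simp [face0, face1]
    have h1 : face1 R (Fin.succ 0) (Fin.cons (x 0) x : Fin (n + 3) → X)
        = face0 (Fin.succ 0) (Fin.cons (x 0) x : Fin (n + 3) → X) := by
      funext j
      refine Fin.cases ?_ (fun j => ?_) j
      · simp [face0, face1, hq]
      · simp [face0, face1]
    have h2 : ∀ i : Fin (n + 1), face0 i.succ.succ (Fin.cons (x 0) x : Fin (n + 3) → X)
        = (Fin.cons (face0 i.succ x 0) (face0 i.succ x) : Fin (n + 2) → X) := by
      intro i; funext j
      refine Fin.cases ?_ (fun j => ?_) j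
      · simp [face0]
      · simp [face0]
    have h3 : ∀ i : Fin (n + 1), face1 R i.succ.succ (Fin.cons (x 0) x : Fin (n + 3) → X)
        = (Fin.cons (face1 R i.succ x 0) (face1 R i.succ x) : Fin (n + 2) → X) := by
      intro i; funext j
      refine Fin.cases ?_ (fun j => ?_) j
      · simp [face1]
      · simp [face1, ← Fin.succ_castSucc]
    simp only [h0, h1, h2, h3, sub_self, smul_zero, zero_add, map_sum, map_zsmul, map_sub, sd_of,
      Fin.val_succ]
    rw [eq_neg_iff_add_eq_zero, ← Finset.sum_add_distrib]
    refine Finset.sum_eq_zero fun i _ => ?_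
    rw [pow_succ _ ((i : ℕ) + 1 + 1), mul_neg_one, neg_smul, neg_add_cancel]
  exact DFunLike.congr_fun this c

lemma sd_memD (n : ℕ) (c : Ch X (n + 1)) : sd n c ∈ CD X (n + 2) := by
  rw [CD_eq]
  apply map_all
  intro x
  rw [sd_of]
  exact of_mem ⟨0, Fin.succ 0, by simp, by simp, by simp⟩

lemma sd_memL (n : ℕ) {c : Ch X (n + 1)} (hc : c ∈ CD X (n + 1)) : sd n c ∈ CL X (n + 2) := by
  rw [CD_eq] at hc
  rw [CL_eq]
  refine CP_map _ ?_ hc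
  rintro x ⟨i, j, -, hij, e⟩
  rw [sd_of]
  exact of_mem ⟨i.succ, j.succ, by simp, by simpa, by simpa⟩

open Classical in
noncomputable def pq (n : ℕ) : Ch X (n + 2) →+ ChQ X (n + 1) :=
  FreeAbelianGroup.lift fun x => if x 0 = x 1 then QuotientAddGroup.mk (of (Fin.tail x)) else 0

lemma pq_sd (n : ℕ) (c : Ch X (n + 1)) : pq n (sd n c) = QuotientAddGroup.mk c := by
  have : (pq n).comp (sd n) = QuotientAddGroup.mk' (CD X (n + 1)) := by
    apply FreeAbelianGroup.lift_ext
    intro x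
    have h : (Fin.cons (x 0) x : Fin (n + 2) → X) 1 = x 0 := by
      rw [← Fin.succ_zero_eq_one, Fin.cons_succ]
    simp only [AddMonoidHom.comp_apply, sd_of, pq, FreeAbelianGroup.lift_apply_of, h, Fin.cons_zero,
      Fin.tail_cons, if_true, QuotientAddGroup.mk'_apply]
  exact DFunLike.congr_fun this c

lemma pq_CL (n : ℕ) {c : Ch X (n + 2)} (hc : c ∈ CL X (n + 2)) : pq n c = 0 := by
  have : CL X (n + 2) ≤ (pq n).ker := by
    rw [CL, AddSubgroup.closure_le]
    rintro _ ⟨x, ⟨i, j, hi, hij, e⟩, rfl⟩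
    change pq n (of x) = 0
    simp only [pq, FreeAbelianGroup.lift_apply_of]
    split_ifs
    · rw [QuotientAddGroup.eq_zero_iff, CD_eq]
      refine of_mem ⟨⟨i - 1, by omega⟩, ⟨j - 1, by omega⟩, by simp, by simp; omega, ?_⟩
      have hi' : (⟨i - 1, by omega⟩ : Fin (n + 1)).succ = i := by ext; simp; omega
      have hj' : (⟨j - 1, by omega⟩ : Fin (n + 1)).succ = j := by ext; simp; omega
      simp only [Fin.tail, hi', hj', e]
    · rfl
  exact this hc

lemma CL_le (n : ℕ) : CL X n ≤ CD X n := by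
  apply AddSubgroup.closure_mono
  apply Set.image_mono
  rintro x ⟨i, j, -, h⟩
  exact ⟨i, j, h⟩

/-- `α` on the quotient. -/
noncomputable def aq (n : ℕ) : ChQ X n →+ Ch X n :=
  QuotientAddGroup.lift (CD X n) (alpha n) (fun c hc => alpha_deg n c hc)

lemma aq_mk (n : ℕ) (c : Ch X n) : aq n (QuotientAddGroup.mk c) = alpha n c := rfl

lemma mk_aq (n : ℕ) (q : ChQ X n) : (QuotientAddGroup.mk (aq n q) : ChQ X n) = q := by
  induction q using QuotientAddGroup.induction_on with
  | H c =>
    rw [aq_mk, eq_comm, QuotientAddGroup.eq]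
    have := alpha_sub_mem n c
    rwa [sub_eq_neg_add] at this

/-- The inverse isomorphism. -/
noncomputable def ff (n : ℕ) : ChQ X (n + 1) × CL X (n + 2) →+ CD X (n + 2) where
  toFun p := ⟨sd n (aq (n + 1) p.1) + p.2, add_mem (sd_memD _ _) (CL_le _ p.2.2)⟩
  map_zero' := by ext; simp
  map_add' p q := by
    ext
    simp only [Prod.fst_add, Prod.snd_add, map_add, AddSubgroup.coe_add]
    abel

lemma ff_coe (n : ℕ) (p : ChQ X (n + 1) × CL X (n + 2)) :
    (ff n p : Ch X (n + 2)) = sd n (aq (n + 1) p.1) + p.2 := rfl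

lemma ff_bij (n : ℕ) : Function.Bijective (ff (X := X) n) := by
  constructor
  · rw [injective_iff_map_eq_zero]
    rintro ⟨q, l⟩ h
    have h1 : sd n (aq (n + 1) q) + (l : Ch X (n + 2)) = 0 := by
      rw [← ff_coe n (q, l), h]; rfl
    have h2 : q = 0 := by
      have := congrArg (pq n) h1
      rwa [map_add, pq_sd, pq_CL n l.2, mk_aq, add_zero, map_zero] at this
    subst h2
    rw [map_zero, map_zero, zero_add] at h1
    ext
    · rfl
    · exact h1
  · have key : AddSubgroup.closure (of '' Deg X (n + 2)) ≤
        (ff (X := X) n).range.map (CD X (n + 2)).subtype := by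
      rw [AddSubgroup.closure_le]
      rintro _ ⟨x, ⟨i, j, hij, e⟩, rfl⟩
      by_cases hi : 1 ≤ (i : ℕ)
      · refine ⟨_, ⟨(0, ⟨of x, AddSubgroup.subset_closure ⟨x, ⟨i, j, hi, hij, e⟩, rfl⟩⟩), rfl⟩, ?_⟩
        rw [AddSubgroup.subtype_apply]
        rw [ff_coe]; simp
      · have hi0 : i = 0 := Fin.ext (by rw [Fin.val_zero]; omega)
        have hj1 : j = Fin.succ 0 :=
          Fin.ext (by rw [Fin.val_succ, Fin.val_zero]; rw [hi0, Fin.val_zero] at hij; omega)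
        subst hi0 hj1
        have hx : of x = sd n (of (Fin.tail x)) := by
          rw [sd_of]
          congr 1
          conv_lhs => rw [← Fin.cons_self_tail x]
          rw [e]; rfl
        have hm := sd_memL n (alpha_sub_mem (n + 1) (of (Fin.tail x)))
        refine ⟨_, ⟨(QuotientAddGroup.mk (of (Fin.tail x)), -⟨_, hm⟩), rfl⟩, ?_⟩
        rw [AddSubgroup.subtype_apply]
        rw [ff_coe, aq_mk, hx]
        simp
    intro c
    obtain ⟨_, ⟨p, rfl⟩, h⟩ := key c.2
    exact ⟨p, Subtype.ext h⟩

end S14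

/-- `C_*^D(X) ≅ C_{*-1}^Q(X) ⊕ C_*^L(X)` as chain complexes: there are boundary
maps `dD`, `dL`, `dQ` restricted/induced by `∂` and degreewise isomorphisms `e`
compatible with the differentials (the shifted complex `C^Q_{*-1}` carries the
differential `-dQ`). -/
theorem stmt14 (R : RackStr X) (hq : ∀ a, R.act a a = a) :
    ∃ (dD : ∀ n : ℕ, CD X (n + 1) →+ CD X n)
      (dL : ∀ n : ℕ, CL X (n + 1) →+ CL X n)
      (dQ : ∀ n : ℕ, ChQ X (n + 2) →+ ChQ X (n + 1))
      (e : ∀ n : ℕ, CD X (n + 2) ≃+ ChQ X (n + 1) × CL X (n + 2)),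
      (∀ (n : ℕ) (c : CD X (n + 1)), (dD n c : Ch X n) = bdry R n (c : Ch X (n + 1))) ∧
      (∀ (n : ℕ) (c : CL X (n + 1)), (dL n c : Ch X n) = bdry R n (c : Ch X (n + 1))) ∧
      (∀ (n : ℕ) (c : Ch X (n + 2)),
        dQ n (QuotientAddGroup.mk c) = QuotientAddGroup.mk (bdry R (n + 1) c)) ∧
      (∀ (n : ℕ) (c : CD X (n + 3)),
        e n (dD (n + 2) c) =
          (-(dQ n ((e (n + 1) c).1)), dL (n + 2) ((e (n + 1) c).2))) := by
  have hD : ∀ (n : ℕ) (c : Ch X (n + 1)), c ∈ CD X (n + 1) → bdry R n c ∈ CD X n := by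
    intro n c hc
    rw [S14.CD_eq] at hc ⊢
    exact S14.bdry_mem R hq (by omega) n hc
  have hL : ∀ (n : ℕ) (c : Ch X (n + 1)), c ∈ CL X (n + 1) → bdry R n c ∈ CL X n :=
    fun n c hc => S14.bdry_mem R hq le_rfl n hc
  let dD : ∀ n : ℕ, CD X (n + 1) →+ CD X n := fun n =>
    ((bdry R n).comp (CD X (n + 1)).subtype).codRestrict (CD X n) (fun c => hD n c c.2)
  let dL : ∀ n : ℕ, CL X (n + 1) →+ CL X n := fun n =>
    ((bdry R n).comp (CL X (n + 1)).subtype).codRestrict (CL X n) (fun c => hL n c c.2)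
  let dQ : ∀ n : ℕ, ChQ X (n + 2) →+ ChQ X (n + 1) := fun n =>
    QuotientAddGroup.map (CD X (n + 2)) (CD X (n + 1)) (bdry R (n + 1)) (fun c hc => hD _ c hc)
  refine ⟨dD, dL, dQ, fun n => (AddEquiv.ofBijective (S14.ff n) (S14.ff_bij n)).symm,
    fun n c => rfl, fun n c => rfl, fun n c => rfl, ?_⟩
  intro n c
  obtain ⟨⟨q, l⟩, rfl⟩ := (AddEquiv.ofBijective (S14.ff (X := X) (n + 1)) (S14.ff_bij (n + 1))).surjective c
  rw [AddEquiv.symm_apply_apply, AddEquiv.symm_apply_eq]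
  apply Subtype.ext
  change bdry R (n + 2) (S14.ff (n + 1) (q, l) : Ch X (n + 3))
    = (S14.ff n (-(dQ n q), dL (n + 2) l) : Ch X (n + 2))
  rw [S14.ff_coe, S14.ff_coe, map_add, S14.bdry_sd R hq, map_neg, map_neg]
  congr 1
  induction q using QuotientAddGroup.induction_on with
  | H c =>
    change _ = -(S14.sd n) (S14.aq (n + 1) (QuotientAddGroup.mk (bdry R (n + 1) c)))
    rw [S14.aq_mk, S14.aq_mk, S14.bdry_alpha R hq]
end

section
/- For any quandle X, H_3 of the complex C_*^L(X) is free abelian with basis indexed by Orb(X)², i.e. H_3^L(X) ≅ ℤ[Orb(X)²]. Concretely, the cycles (x,y,y) generate H_3^L(X), and (x,y,y) is homologous to (x',y',y') iff x,x' lie in the same orbit and y,y' lie in the same orbit. -/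
variable {X : Type}

/-- The set of orbits of a rack. -/
def Orb (R : RackStr X) : Type := Quot fun a b => ∃ c, R.act a c = b

/-- Same-orbit relation. -/
def orbRel (R : RackStr X) : X → X → Prop :=
  Relation.EqvGen fun a b => ∃ c, R.act a c = b

/-- The cycles of `C_3^L(X)`. -/
def ZL3 (R : RackStr X) : AddSubgroup (Ch X 3) := CL X 3 ⊓ (bdry R 2).ker

/-- The boundaries coming from `C_4^L(X)`, viewed inside the cycles. -/
def BL3 (R : RackStr X) : AddSubgroup (ZL3 R) :=
  AddSubgroup.comap (ZL3 R).subtype ((CL X 4).map (bdry R 3))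

/-- `H_3^L(X)`. -/
abbrev H3L (R : RackStr X) := ZL3 R ⧸ BL3 R


open FreeAbelianGroup in
theorem bdry_xyy (R : RackStr X) (hq : ∀ a, R.act a a = a) (x y : X) :
    bdry R 2 (of ![x, y, y]) = 0 := by
  have e0 : face0 (0 : Fin 3) ![x, y, y] = ![y, y] := by
    funext j; fin_cases j <;> rfl
  have e1 : face0 (1 : Fin 3) ![x, y, y] = ![x, y] := by
    funext j; fin_cases j <;> rfl
  have e2 : face0 (2 : Fin 3) ![x, y, y] = ![x, y] := by
    funext j; fin_cases j <;> rfl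
  have f0 : face1 R (0 : Fin 3) ![x, y, y] = ![y, y] := by
    funext j; fin_cases j <;> rfl
  have f1 : face1 R (1 : Fin 3) ![x, y, y] = ![R.act x y, y] := by
    funext j; fin_cases j <;> rfl
  have f2 : face1 R (2 : Fin 3) ![x, y, y] = ![R.act x y, y] := by
    funext j; fin_cases j
    · rfl
    · exact hq y
  rw [bdry, lift_apply_of, Fin.sum_univ_three, e0, e1, e2, f0, f1, f2]
  simp

open FreeAbelianGroup in
theorem bdry_xyyz (R : RackStr X) (hq : ∀ a, R.act a a = a) (x y z : X) :
    bdry R 3 (of ![x, y, y, z]) =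
      of ![x, y, y] - of ![R.act x z, R.act y z, R.act y z] := by
  have e0 : face0 (0 : Fin 4) ![x, y, y, z] = ![y, y, z] := by
    funext j; fin_cases j <;> rfl
  have e1 : face0 (1 : Fin 4) ![x, y, y, z] = ![x, y, z] := by
    funext j; fin_cases j <;> rfl
  have e2 : face0 (2 : Fin 4) ![x, y, y, z] = ![x, y, z] := by
    funext j; fin_cases j <;> rfl
  have e3 : face0 (3 : Fin 4) ![x, y, y, z] = ![x, y, y] := by
    funext j; fin_cases j <;> rfl
  have f0 : face1 R (0 : Fin 4) ![x, y, y, z] = ![y, y, z] := by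
    funext j; fin_cases j <;> rfl
  have f1 : face1 R (1 : Fin 4) ![x, y, y, z] = ![R.act x y, y, z] := by
    funext j; fin_cases j <;> rfl
  have f2 : face1 R (2 : Fin 4) ![x, y, y, z] = ![R.act x y, y, z] := by
    funext j; fin_cases j
    · rfl
    · exact hq y
    · rfl
  have f3 : face1 R (3 : Fin 4) ![x, y, y, z] = ![R.act x z, R.act y z, R.act y z] := by
    funext j; fin_cases j <;> rfl
  rw [bdry, lift_apply_of, Fin.sum_univ_four, e0, e1, e2, e3, f0, f1, f2, f3]
  simp

open FreeAbelianGroup in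
theorem bdry_xzyy (R : RackStr X) (hq : ∀ a, R.act a a = a) (x z y : X) :
    bdry R 3 (of ![x, z, y, y]) = of ![x, y, y] - of ![R.act x z, y, y] := by
  have e0 : face0 (0 : Fin 4) ![x, z, y, y] = ![z, y, y] := by
    funext j; fin_cases j <;> rfl
  have e1 : face0 (1 : Fin 4) ![x, z, y, y] = ![x, y, y] := by
    funext j; fin_cases j <;> rfl
  have e2 : face0 (2 : Fin 4) ![x, z, y, y] = ![x, z, y] := by
    funext j; fin_cases j <;> rfl
  have e3 : face0 (3 : Fin 4) ![x, z, y, y] = ![x, z, y] := by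
    funext j; fin_cases j <;> rfl
  have f0 : face1 R (0 : Fin 4) ![x, z, y, y] = ![z, y, y] := by
    funext j; fin_cases j <;> rfl
  have f1 : face1 R (1 : Fin 4) ![x, z, y, y] = ![R.act x z, y, y] := by
    funext j; fin_cases j <;> rfl
  have f2 : face1 R (2 : Fin 4) ![x, z, y, y] = ![R.act x y, R.act z y, y] := by
    funext j; fin_cases j <;> rfl
  have f3 : face1 R (3 : Fin 4) ![x, z, y, y] = ![R.act x y, R.act z y, y] := by
    funext j; fin_cases j
    · rfl
    · rfl
    · exact hq y
  rw [bdry, lift_apply_of, Fin.sum_univ_four, e0, e1, e2, e3, f0, f1, f2, f3]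
  simp
  abel

theorem LDeg_three (v : Fin 3 → X) (hv : v ∈ LDeg X 3) : v = ![v 0, v 1, v 1] := by
  obtain ⟨i, j, hi, hij, h⟩ := hv
  have hi' : i = 1 := by ext; simp; omega
  have hj' : j = 2 := by ext; simp; omega
  subst hi' hj'
  funext k; fin_cases k
  · rfl
  · rfl
  · exact h.symm

theorem LDeg_four (v : Fin 4 → X) (hv : v ∈ LDeg X 4) :
    v = ![v 0, v 1, v 1, v 3] ∨ v = ![v 0, v 1, v 2, v 2] := by
  obtain ⟨i, j, hi, hij, h⟩ := hv
  have hc : (i = 1 ∧ j = 2) ∨ (i = 2 ∧ j = 3) := by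
    have := j.2
    simp only [Fin.ext_iff]
    simp
    omega
  rcases hc with ⟨rfl, rfl⟩ | ⟨rfl, rfl⟩
  · left
    funext k; fin_cases k
    · rfl
    · rfl
    · exact h.symm
    · rfl
  · right
    funext k; fin_cases k
    · rfl
    · rfl
    · rfl
    · exact h.symm

theorem xyy_mem (R : RackStr X) (hq : ∀ a, R.act a a = a) (x y : X) :
    FreeAbelianGroup.of ![x, y, y] ∈ ZL3 R :=
  ⟨AddSubgroup.subset_closure ⟨_, ⟨1, 2, le_refl _, rfl, rfl⟩, rfl⟩, bdry_xyy R hq x y⟩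

/-- The class of `(x,y,y)` in `H_3^L`. -/
def cls (R : RackStr X) (hq : ∀ a, R.act a a = a) (x y : X) : H3L R :=
  QuotientAddGroup.mk ⟨FreeAbelianGroup.of ![x, y, y], xyy_mem R hq x y⟩

theorem cls_eq_of (R : RackStr X) (hq : ∀ a, R.act a a = a) (x y x' y' : X)
    (w : Fin 4 → X) (hw : w ∈ LDeg X 4)
    (h : bdry R 3 (FreeAbelianGroup.of w) =
      FreeAbelianGroup.of ![x, y, y] - FreeAbelianGroup.of ![x', y', y']) :
    cls R hq x y = cls R hq x' y' := by
  symm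
  refine (QuotientAddGroup.eq).2 ?_
  refine AddSubgroup.mem_comap.2 ⟨FreeAbelianGroup.of w,
    AddSubgroup.subset_closure ⟨w, hw, rfl⟩, ?_⟩
  rw [h]
  simp [sub_eq_neg_add]

theorem cls_left (R : RackStr X) (hq : ∀ a, R.act a a = a) (x y z : X) :
    cls R hq x y = cls R hq (R.act x z) y :=
  cls_eq_of R hq _ _ _ _ ![x, z, y, y] ⟨2, 3, by simp, rfl, rfl⟩ (bdry_xzyy R hq x z y)

theorem cls_right (R : RackStr X) (hq : ∀ a, R.act a a = a) (x y z : X) :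
    cls R hq x y = cls R hq x (R.act y z) :=
  (cls_eq_of R hq _ _ _ _ ![x, y, y, z] ⟨1, 2, by simp, rfl, rfl⟩
    (bdry_xyyz R hq x y z)).trans (cls_left R hq x (R.act y z) z).symm

theorem cls_gen (R : RackStr X) (hq : ∀ a, R.act a a = a) (h : H3L R) :
    h ∈ AddSubgroup.closure {c : H3L R | ∃ x y : X, c = cls R hq x y} := by
  induction h using QuotientAddGroup.induction_on with
  | H z =>
    obtain ⟨c, hc⟩ := z
    have key : ∀ c ∈ CL X 3, ∃ hc : c ∈ ZL3 R, (QuotientAddGroup.mk ⟨c, hc⟩ : H3L R) ∈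
        AddSubgroup.closure {c : H3L R | ∃ x y : X, c = cls R hq x y} := by
      intro c hc
      induction hc using AddSubgroup.closure_induction with
      | mem a ha =>
        obtain ⟨v, hv, rfl⟩ := ha
        rw [LDeg_three v hv]
        exact ⟨xyy_mem R hq _ _, AddSubgroup.subset_closure ⟨_, _, rfl⟩⟩
      | zero => exact ⟨zero_mem _, zero_mem _⟩
      | add a b _ _ ha hb =>
        obtain ⟨ha, ha'⟩ := ha
        obtain ⟨hb, hb'⟩ := hb
        exact ⟨add_mem ha hb, add_mem ha' hb'⟩
      | neg a _ ha =>
        obtain ⟨ha, ha'⟩ := ha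
        exact ⟨neg_mem ha, neg_mem ha'⟩
    exact (key c hc.1).2

/-- The map `v ↦ ([v 0], [v 1])`. -/
def toOrb (R : RackStr X) : Ch X 3 →+ FreeAbelianGroup (Orb R × Orb R) :=
  FreeAbelianGroup.lift fun v => FreeAbelianGroup.of (Quot.mk _ (v 0), Quot.mk _ (v 1))

theorem toOrb_bdry (R : RackStr X) (hq : ∀ a, R.act a a = a) (c : Ch X 4) (hc : c ∈ CL X 4) :
    toOrb R (bdry R 3 c) = 0 := by
  have hm : ∀ x z : X, (Quot.mk _ (R.act x z) : Orb R) = Quot.mk _ x :=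
    fun x z => (Quot.sound ⟨z, rfl⟩).symm
  induction hc using AddSubgroup.closure_induction with
  | mem a ha =>
    obtain ⟨v, hv, rfl⟩ := ha
    rcases LDeg_four v hv with h | h
    · rw [h, bdry_xyyz R hq, map_sub, toOrb, FreeAbelianGroup.lift_apply_of,
        FreeAbelianGroup.lift_apply_of]
      simp [hm]
    · rw [h, bdry_xzyy R hq, map_sub, toOrb, FreeAbelianGroup.lift_apply_of,
        FreeAbelianGroup.lift_apply_of]
      simp [hm]
  | zero => simp
  | add a b _ _ ha hb => simp [ha, hb]
  | neg a _ ha => simp [ha]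

/-- The induced map on homology. -/
def toOrbH (R : RackStr X) (hq : ∀ a, R.act a a = a) :
    H3L R →+ FreeAbelianGroup (Orb R × Orb R) :=
  QuotientAddGroup.lift (BL3 R) ((toOrb R).comp (ZL3 R).subtype) (by
    rintro z ⟨c, hc, h⟩
    show toOrb R ((ZL3 R).subtype z) = 0
    rw [← h]
    exact toOrb_bdry R hq c hc)

/-- The inverse map. -/
def fromOrb (R : RackStr X) (hq : ∀ a, R.act a a = a) :
    FreeAbelianGroup (Orb R × Orb R) →+ H3L R :=
  FreeAbelianGroup.lift fun p => Quot.lift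
    (fun x => Quot.lift (fun y => cls R hq x y)
      (by rintro a b ⟨c, rfl⟩; exact cls_right R hq x a c) p.2)
    (by
      rintro a b ⟨c, rfl⟩
      obtain ⟨p1, q⟩ := p
      induction q using Quot.ind
      exact cls_left R hq a _ c) p.1

/-- The orbit of an element. -/
def omk (R : RackStr X) (x : X) : Orb R := Quot.mk _ x

theorem toOrbH_cls (R : RackStr X) (hq : ∀ a, R.act a a = a) (x y : X) :
    toOrbH R hq (cls R hq x y) = FreeAbelianGroup.of (omk R x, omk R y) := by
  show toOrb R (FreeAbelianGroup.of ![x, y, y]) = _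
  rw [toOrb, FreeAbelianGroup.lift_apply_of]
  rfl

theorem fromOrb_of (R : RackStr X) (hq : ∀ a, R.act a a = a) (x y : X) :
    fromOrb R hq (FreeAbelianGroup.of (omk R x, omk R y)) = cls R hq x y := by
  rw [fromOrb, FreeAbelianGroup.lift_apply_of]
  rfl

theorem from_to (R : RackStr X) (hq : ∀ a, R.act a a = a) (h : H3L R) :
    fromOrb R hq (toOrbH R hq h) = h := by
  induction cls_gen R hq h using AddSubgroup.closure_induction with
  | mem a ha =>
    obtain ⟨x, y, rfl⟩ := ha
    rw [toOrbH_cls, fromOrb_of]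
  | zero => simp
  | add a b _ _ ha hb => rw [map_add, map_add, ha, hb]
  | neg a _ ha => rw [map_neg, map_neg, ha]

theorem to_from (R : RackStr X) (hq : ∀ a, R.act a a = a)
    (u : FreeAbelianGroup (Orb R × Orb R)) : toOrbH R hq (fromOrb R hq u) = u := by
  have : (toOrbH R hq).comp (fromOrb R hq) = AddMonoidHom.id _ := by
    apply FreeAbelianGroup.lift_ext
    rintro ⟨p, q⟩
    obtain ⟨x, rfl⟩ : ∃ x, omk R x = p := Quot.exists_rep p
    obtain ⟨y, rfl⟩ : ∃ y, omk R y = q := Quot.exists_rep q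
    rw [AddMonoidHom.comp_apply, fromOrb_of, toOrbH_cls, AddMonoidHom.id_apply]
  exact DFunLike.congr_fun this u

/-- `H_3^L(X) ≅ ℤ[Orb(X)²]`: the triples `(x,y,y)` are cycles in `C_3^L`, their
classes generate `H_3^L(X)`, they map to the corresponding basis elements of the
free abelian group on `Orb(X)²`, and two such classes agree iff the first and
second coordinates are respectively in the same orbits. -/
theorem stmt15 (R : RackStr X) (hq : ∀ a, R.act a a = a) :
    (∀ x y : X, FreeAbelianGroup.of ![x, y, y] ∈ ZL3 R) ∧
    ∃ φ : H3L R ≃+ FreeAbelianGroup (Orb R × Orb R),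
      (∀ (x y : X) (h : FreeAbelianGroup.of ![x, y, y] ∈ ZL3 R),
        φ (QuotientAddGroup.mk ⟨FreeAbelianGroup.of ![x, y, y], h⟩) =
          FreeAbelianGroup.of (Quot.mk _ x, Quot.mk _ y)) ∧
      (∀ (x y x' y' : X) (h : FreeAbelianGroup.of ![x, y, y] ∈ ZL3 R)
          (h' : FreeAbelianGroup.of ![x', y', y'] ∈ ZL3 R),
        (QuotientAddGroup.mk ⟨FreeAbelianGroup.of ![x, y, y], h⟩ : H3L R) =
            QuotientAddGroup.mk ⟨FreeAbelianGroup.of ![x', y', y'], h'⟩ ↔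
          orbRel R x x' ∧ orbRel R y y') ∧
      (∀ h : H3L R, h ∈ AddSubgroup.closure
        {c : H3L R | ∃ (x y : X) (hm : FreeAbelianGroup.of ![x, y, y] ∈ ZL3 R),
          c = QuotientAddGroup.mk ⟨FreeAbelianGroup.of ![x, y, y], hm⟩}) := by
  refine ⟨xyy_mem R hq, ⟨⟨toOrbH R hq, fromOrb R hq, from_to R hq, to_from R hq⟩, map_add _⟩,
    fun x y _ => toOrbH_cls R hq x y, ?_, ?_⟩
  · intro x y x' y' _ _
    constructor
    · intro h
      have h2 := congrArg (toOrbH R hq) h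
      have h3 := (toOrbH_cls R hq x y).symm.trans (h2.trans (toOrbH_cls R hq x' y'))
      have h4 := FreeAbelianGroup.of_injective h3
      rw [Prod.mk.injEq] at h4
      exact ⟨Quot.eqvGen_exact h4.1, Quot.eqvGen_exact h4.2⟩
    · rintro ⟨h1, h2⟩
      show cls R hq x y = cls R hq x' y'
      have h3 : omk R x = omk R x' := Quot.eqvGen_sound h1
      have h4 : omk R y = omk R y' := Quot.eqvGen_sound h2
      rw [← fromOrb_of, ← fromOrb_of, h3, h4]
  · intro h
    refine AddSubgroup.closure_mono ?_ (cls_gen R hq h)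
    rintro c ⟨x, y, rfl⟩
    exact ⟨x, y, xyy_mem R hq x y, rfl⟩
end

section
/- Let X be a finite rack with homogeneous orbits. Define φⁿ_n : C_n^R(X) → C_n^R(X) by φⁿ_n(x₁,…,xₙ) = ∑_{(y₁,…,yₙ) ∈ Xⁿ} (x₁^{y₁},…,xₙ^{yₙ}). Then φⁿ_n equals ψₙ ∘ πₙ, where π : C_*^R(X) → C_*^R(Orb X) is induced by the orbit projection and ψₙ(ω₁,…,ωₙ) = (∏ᵢ N_{ωᵢ}) · ∑_{zⱼ ∈ ωⱼ} (z₁,…,zₙ), and ψ ∘ π induces multiplication by |X|ⁿ on H_n^R(X). -/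
variable {X : Type}

/-- `N a b` is the number of `c` with `a^c = b`. -/
noncomputable def Nf (R : RackStr X) (a b : X) : ℕ :=
  Nat.card {c : X // R.act a c = b}

/-- Homogeneous orbits: `N a b` depends only on the common orbit of `a,b`. -/
def Homog (R : RackStr X) : Prop :=
  ∀ a b a' b', orbRel R a b → orbRel R b a' → orbRel R a' b' → Nf R a b = Nf R a' b'

/-- `φₙⁿ(x₁,…,xₙ) = ∑_{y ∈ Xⁿ} (x₁^{y₁},…,xₙ^{yₙ})`. -/
noncomputable def phi (R : RackStr X) [Fintype X] (n : ℕ) : Ch X n →+ Ch X n :=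
  FreeAbelianGroup.lift fun x =>
    ∑ y : Fin n → X, FreeAbelianGroup.of fun i => R.act (x i) (y i)

/-- `π`, induced by the orbit projection. -/
def projO (R : RackStr X) (n : ℕ) : Ch X n →+ FreeAbelianGroup (Fin n → Orb R) :=
  FreeAbelianGroup.lift fun x => FreeAbelianGroup.of fun i => Quot.mk _ (x i)

open Classical in
/-- `ψₙ(ω₁,…,ωₙ) = (∏ᵢ N_{ωᵢ}) ∑_{zⱼ ∈ ωⱼ} (z₁,…,zₙ)`, where `N_ω = |X|/|ω|`. -/
noncomputable def psi (R : RackStr X) [Fintype X] (n : ℕ) :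
    FreeAbelianGroup (Fin n → Orb R) →+ Ch X n :=
  FreeAbelianGroup.lift fun ω =>
    (∏ i : Fin n, Fintype.card X / Nat.card {x : X // Quot.mk _ x = ω i}) •
      ∑ z : Fin n → X,
        if ∀ i, Quot.mk _ (z i) = ω i then FreeAbelianGroup.of z else 0


namespace RackAux

theorem nf_zero (R : RackStr X) {a b : X} (h : ¬ orbRel R a b) : Nf R a b = 0 := by
  have : IsEmpty {c : X // R.act a c = b} :=
    ⟨fun c => h (Relation.EqvGen.rel _ _ ⟨c.1, c.2⟩)⟩
  exact Nat.card_of_isEmpty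

theorem nf_eq (R : RackStr X) (hh : Homog R) {a a' : X} (h : orbRel R a a') (b : X) :
    Nf R a b = Nf R a' b := by
  by_cases hb : orbRel R a b
  · exact hh a b a' b hb ((hb.symm _ _).trans _ _ _ h) ((h.symm _ _).trans _ _ _ hb)
  · rw [nf_zero R hb, nf_zero R]
    exact fun h' => hb (h.trans _ _ _ h')

theorem exists_perm (R : RackStr X) [Fintype X] (hh : Homog R) {a a' : X} (h : orbRel R a a') :
    ∃ s : Equiv.Perm X, ∀ y, R.act a' (s y) = R.act a y := by
  have e0 : ∀ b, Nonempty ({c : X // R.act a c = b} ≃ {c : X // R.act a' c = b}) := fun b =>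
    Finite.card_eq.mp (nf_eq R hh h b)
  have e := fun b => (e0 b).some
  refine ⟨((Equiv.sigmaFiberEquiv (R.act a)).symm.trans (Equiv.sigmaCongrRight e)).trans
    (Equiv.sigmaFiberEquiv (R.act a')), fun y => ?_⟩
  exact (e (R.act a y) ⟨y, rfl⟩).2

theorem exists_s1 (R : RackStr X) [Fintype X] (hh : Homog R) (a u : X) :
    ∃ s : Equiv.Perm X, ∀ y, R.act (R.act a u) (s y) = R.act a y :=
  exists_perm R hh (Relation.EqvGen.rel _ _ ⟨u, rfl⟩)

theorem exists_s2 (R : RackStr X) [Fintype X] (hh : Homog R) (a u : X) :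
    ∃ s : Equiv.Perm X, ∀ y, R.act (R.act a (s y)) u = R.act a y := by
  obtain ⟨s, hs⟩ := exists_s1 R hh a u
  refine ⟨s.trans (Equiv.ofBijective _ (R.bij u)).symm, fun y => ?_⟩
  rw [R.distrib]
  have := Equiv.apply_symm_apply (Equiv.ofBijective _ (R.bij u)) (s y)
  simp only [Equiv.ofBijective_apply] at this
  simp only [Equiv.trans_apply]
  rw [this, hs]

/-- Extension of a tuple to all natural indices by a default value. -/
def ext (x0 : X) {m : ℕ} (x : Fin m → X) (k : ℕ) : X := if h : k < m then x ⟨k, h⟩ else x0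

theorem ext_lt (x0 : X) {m : ℕ} (x : Fin m → X) (k : ℕ) (h : k < m) : ext x0 x k = x ⟨k, h⟩ := by
  simp [ext, h]

theorem ext_ge (x0 : X) {m : ℕ} (x : Fin m → X) (k : ℕ) (h : ¬ k < m) : ext x0 x k = x0 := by
  simp [ext, h]

theorem face0_apply (x0 : X) {m : ℕ} (i : Fin (m + 1)) (x : Fin (m + 1) → X) (k : Fin m) :
    face0 i x k = if (k : ℕ) < i then ext x0 x k else ext x0 x (k + 1) := by
  unfold face0
  split_ifs with h
  · rw [ext_lt _ _ _ (by omega), Fin.succAbove_of_castSucc_lt _ _ (by simpa [Fin.lt_def] using h)]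
    rfl
  · rw [ext_lt _ _ _ (by omega), Fin.succAbove_of_le_castSucc _ _ (by simpa [Fin.le_def] using h)]
    rfl

theorem face1_apply (R : RackStr X) (x0 : X) {m : ℕ} (i : Fin (m + 1)) (x : Fin (m + 1) → X)
    (k : Fin m) :
    face1 R i x k =
      if (k : ℕ) < i then R.act (ext x0 x k) (ext x0 x i) else ext x0 x (k + 1) := by
  unfold face1
  rw [ext_lt _ _ k (by omega), ext_lt _ _ (k + 1) (by omega), ext_lt _ _ i (by omega)]
  rfl

theorem ext_face0 (x0 : X) {m : ℕ} (i : Fin (m + 1)) (x : Fin (m + 1) → X) (k : ℕ) :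
    ext x0 (face0 i x) k = if k < i then ext x0 x k else ext x0 x (k + 1) := by
  by_cases h : k < m
  · rw [ext_lt _ _ _ h, face0_apply x0]
  · rw [ext_ge _ _ _ h, if_neg (by omega), ext_ge _ _ _ (by omega)]

theorem ext_face1 (R : RackStr X) (x0 : X) {m : ℕ} (i : Fin (m + 1)) (x : Fin (m + 1) → X)
    (k : ℕ) : ext x0 (face1 R i x) k =
      if k < i then R.act (ext x0 x k) (ext x0 x i) else ext x0 x (k + 1) := by
  by_cases h : k < m
  · rw [ext_lt _ _ _ h, face1_apply R x0]
  · rw [ext_ge _ _ _ h, if_neg (by omega), ext_ge _ _ _ (by omega)]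

/-- The natural-number-indexed homotopy tuple
`(x₀^{y₀},…,x_{j-1}^{y_{j-1}}, x_j, y_j, x_{j+1},…)`. -/
def dn (R : RackStr X) (j : ℕ) (x y : ℕ → X) (k : ℕ) : X :=
  if k < j then R.act (x k) (y k) else if k = j then x j else
    if k = j + 1 then y j else x (k - 1)

/-- The finite homotopy tuple. -/
def dd (R : RackStr X) (x0 : X) (j : ℕ) {m N : ℕ} (x : Fin m → X) (y : Fin N → X) :
    Fin (m + 1) → X := fun k => dn R j (ext x0 x) (ext x0 y) k

theorem ext_dd (R : RackStr X) (x0 : X) (j : ℕ) {m N : ℕ} (x : Fin m → X) (y : Fin N → X)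
    (k : ℕ) (hk : k < m + 1) : ext x0 (dd R x0 j x y) k = dn R j (ext x0 x) (ext x0 y) k := by
  rw [ext_lt _ _ _ hk]; rfl

/-- The homotopy. -/
noncomputable def DD (R : RackStr X) [Fintype X] (x0 : X) (j m N : ℕ) : Ch X m →+ Ch X (m + 1) :=
  FreeAbelianGroup.lift fun x => ∑ y : Fin N → X, FreeAbelianGroup.of (dd R x0 j x y)

/-- Partial averaging tuple. -/
def qq (R : RackStr X) (j : ℕ) {n : ℕ} (x y : Fin n → X) : Fin n → X :=
  fun i => if (i : ℕ) < j then R.act (x i) (y i) else x i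

/-- Partial averaging. -/
noncomputable def QQ (R : RackStr X) [Fintype X] (j n : ℕ) : Ch X n →+ Ch X n :=
  FreeAbelianGroup.lift fun x => ∑ y : Fin n → X, FreeAbelianGroup.of (qq R j x y)

theorem sum_eq [Fintype X] {M : Type} [AddCommGroup M] {N : ℕ} (F G : (Fin N → X) → M)
    (t : (Fin N → X) → (Fin N → X)) (ht : Function.Injective t) (h : ∀ y, F y = G (t y)) :
    ∑ y, F y = ∑ y, G y := by
  classical
  rw [← (Finite.injective_iff_bijective.mp ht).sum_comp G]
  exact Finset.sum_congr rfl fun y _ => h y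

/-- Change of variables: permute the coordinates below `i`, with permutations depending on a
value determined by the coordinates from `i` on. -/
def tt {N : ℕ} (i : ℕ) (u : (Fin N → X) → X) (s : Fin N → X → Equiv.Perm X) (y : Fin N → X) :
    Fin N → X := fun k => if (k : ℕ) < i then s k (u y) (y k) else y k

theorem tt_inj {N : ℕ} (i : ℕ) (u : (Fin N → X) → X) (s : Fin N → X → Equiv.Perm X)
    (hu : ∀ y y' : Fin N → X, (∀ k : Fin N, i ≤ (k : ℕ) → y k = y' k) → u y = u y') :
    Function.Injective (tt i u s) := by
  intro y y' h
  have h1 : ∀ k : Fin N, i ≤ (k : ℕ) → y k = y' k := fun k hk => by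
    have := congrFun h k
    simpa [tt, not_lt.mpr hk] using this
  have h2 := hu y y' h1
  funext k
  by_cases hk : (k : ℕ) < i
  · have := congrFun h k
    simpa [tt, hk, h2] using this
  · exact h1 k (not_lt.mp hk)

theorem ext_tt (x0 : X) {N : ℕ} (i : ℕ) (u : (Fin N → X) → X) (s : Fin N → X → Equiv.Perm X)
    (y : Fin N → X) (k : ℕ) (hk : ¬ k < i) : ext x0 (tt i u s y) k = ext x0 y k := by
  unfold ext tt
  split_ifs
  all_goals rfl

theorem ext_tt' (x0 : X) {N : ℕ} (i : ℕ) (u : (Fin N → X) → X) (s : Fin N → X → Equiv.Perm X)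
    (y : Fin N → X) (k : ℕ) (hk : k < i) (hN : k < N) :
    ext x0 (tt i u s y) k = s ⟨k, hN⟩ (u y) (ext x0 y k) := by
  simp [ext, tt, hk, hN]


theorem dn_congr (R : RackStr X) (i j k : ℕ) (x y y' : ℕ → X) (h : ∀ l, i ≤ l → y l = y' l)
    (hk : i ≤ k) (hj : i ≤ j) : dn R j x y k = dn R j x y' k := by
  unfold dn
  rw [h k hk, h j hj]

theorem T1 (R : RackStr X) [Fintype X] (hh : Homog R) (x0 : X) {n : ℕ} (j : Fin (n + 1))
    (x : Fin (n + 1) → X) (i : Fin (n + 2)) (hij : (i : ℕ) ≤ j) :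
    ∑ y : Fin (n + 1) → X, FreeAbelianGroup.of (face0 i (dd R x0 j x y)) =
    ∑ y : Fin (n + 1) → X, FreeAbelianGroup.of (face1 R i (dd R x0 j x y)) := by
  choose s hs using exists_s2 R hh
  let u : (Fin (n + 1) → X) → X := fun y => dn R j (ext x0 x) (ext x0 y) i
  let t := tt (N := n + 1) i u (fun k w => s (ext x0 x k) w)
  refine sum_eq _ _ t (tt_inj _ _ _ ?_) fun y => ?_
  · intro y y' h
    refine dn_congr R i j i _ _ _ (fun l hl => ?_) le_rfl hij
    unfold ext
    split_ifs
    · exact h _ hl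
    · rfl
  · congr 1
    funext k
    have hl : ∀ l, (i : ℕ) ≤ l → ext x0 (t y) l = ext x0 y l := fun l hl =>
      ext_tt x0 _ _ _ _ _ (by omega)
    rw [face0_apply x0, face1_apply R x0, ext_dd _ _ _ _ _ _ (by omega),
      ext_dd _ _ _ _ _ _ (by omega), ext_dd _ _ _ _ _ _ (by omega),
      ext_dd _ _ _ _ _ _ (by omega), ext_dd _ _ _ _ _ _ (by omega)]
    split_ifs with hk
    · rw [dn_congr R i j i _ (ext x0 (t y)) (ext x0 y) hl le_rfl hij]
      have e1 : dn R j (ext x0 x) (ext x0 (t y)) k = R.act (ext x0 x k) (ext x0 (t y) k) := by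
        unfold dn; rw [if_pos (by omega)]
      have e2 : dn R j (ext x0 x) (ext x0 y) k = R.act (ext x0 x k) (ext x0 y k) := by
        unfold dn; rw [if_pos (by omega)]
      rw [e1, e2, ext_tt' x0 _ _ _ _ _ hk (by omega), hs]
    · exact (dn_congr R i j _ _ (ext x0 (t y)) (ext x0 y) hl (by omega) hij).symm

theorem T2a (R : RackStr X) (x0 : X) {n : ℕ} (j : Fin (n + 1))
    (x y : Fin (n + 1) → X) :
    face0 j.succ (dd R x0 j x y) = qq R j x y := by
  funext k
  rw [face0_apply x0, ext_dd _ _ _ _ _ _ (by omega), ext_dd _ _ _ _ _ _ (by omega)]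
  simp only [dn, qq, Fin.val_succ]
  rw [ext_lt _ y k (by omega), ext_lt _ x k (by omega), ext_lt _ x j (by omega)]
  by_cases h1 : (k : ℕ) < j
  · rw [if_pos (by omega), if_pos h1, if_pos h1]
  · by_cases h2 : k = j
    · subst h2; simp
    · have h3 : (k : ℕ) ≠ j := fun h => h2 (Fin.ext h)
      rw [if_neg (by omega), if_neg (by omega), if_neg (by omega), if_neg (by omega), if_neg h1,
        Nat.add_sub_cancel, ext_lt _ x k (by omega)]

theorem T2b (R : RackStr X) [Fintype X] (hh : Homog R) (x0 : X) {n : ℕ} (j : Fin (n + 1))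
    (x : Fin (n + 1) → X) :
    ∑ y : Fin (n + 1) → X, FreeAbelianGroup.of (qq R (j + 1) x y) =
    ∑ y : Fin (n + 1) → X, FreeAbelianGroup.of (face1 R j.succ (dd R x0 j x y)) := by
  choose s hs using exists_s2 R hh
  let t := tt (N := n + 1) j (fun y => y j) (fun k w => s (ext x0 x k) w)
  refine sum_eq _ _ t (tt_inj _ _ _ fun y y' h => h _ le_rfl) fun y => ?_
  congr 1
  funext k
  rw [face1_apply R x0, ext_dd _ _ _ _ _ _ (by omega), ext_dd _ _ _ _ _ _ (by simp; omega),
    ext_dd _ _ _ _ _ _ (by omega)]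
  have hj : ext x0 (t y) j = y j := by
    rw [ext_tt x0 _ _ _ _ _ (by omega), ext_lt _ _ _ (by omega)]
  simp only [dn, qq, Fin.val_succ, hj]
  by_cases h1 : (k : ℕ) < j
  · rw [if_pos (by omega), if_pos (by omega), if_pos h1, if_neg (by omega), if_neg (by omega),
      if_pos trivial, ext_tt' x0 _ _ _ _ _ h1 (by omega), hs, ext_lt _ x k (by omega),
      ext_lt _ y k (by omega)]
  · by_cases h2 : k = j
    · subst h2
      simp [ext_lt x0 x k (by omega)]
    · have h3 : (k : ℕ) ≠ j := fun h => h2 (Fin.ext h)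
      rw [if_neg (by omega), if_neg (by omega), if_neg (by omega), if_neg (by omega),
        if_neg (by omega), Nat.add_sub_cancel, ext_lt _ x k (by omega)]

theorem T3 (R : RackStr X) (x0 : X) {n : ℕ} (j : Fin (n + 1))
    (x y : Fin (n + 1) → X) (i : Fin (n + 1)) (hij : (j : ℕ) < i) :
    face0 i.succ (dd R x0 j x y) = dd R x0 j (face0 i x) y := by
  funext k
  rw [face0_apply x0, ext_dd _ _ _ _ _ _ (by omega), ext_dd _ _ _ _ _ _ (by omega)]
  simp only [dn, dd, Fin.val_succ, ext_face0]
  by_cases h1 : (k : ℕ) < j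
  · rw [if_pos (by omega), if_pos h1, if_pos h1, if_pos (by omega)]
  by_cases h2 : (k : ℕ) = j
  · rw [if_pos (by omega), if_neg h1, if_neg h1, if_pos h2, if_pos h2, if_pos hij]
  by_cases h3 : (k : ℕ) = j + 1
  · rw [if_pos (by omega), if_neg h1, if_neg h1, if_neg h2, if_neg h2, if_pos h3, if_pos h3]
  by_cases h4 : (k : ℕ) < i + 1
  · rw [if_pos (by omega), if_neg h1, if_neg h1, if_neg h2, if_neg h2, if_neg h3, if_neg h3,
      if_pos (by omega)]
  · rw [if_neg (by omega), if_neg (by omega), if_neg (by omega), if_neg (by omega), if_neg h1,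
      if_neg h2, if_neg h3, if_neg (by omega)]
    congr 1; omega

theorem T4 (R : RackStr X) [Fintype X] (x0 : X) {n : ℕ} (j : Fin (n + 1))
    (x : Fin (n + 1) → X) (i : Fin (n + 1)) (hij : (j : ℕ) < i) :
    ∑ y : Fin (n + 1) → X, FreeAbelianGroup.of (face1 R i.succ (dd R x0 j x y)) =
    ∑ y : Fin (n + 1) → X, FreeAbelianGroup.of (dd R x0 j (face1 R i x) y) := by
  refine sum_eq _ _ (fun y k => R.act (y k) (x i)) ?_ fun y => ?_
  · intro y y' h
    funext k
    exact (R.bij (x i)).1 (congrFun h k)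
  congr 1
  funext k
  have hxi : ext x0 x i = x i := ext_lt _ _ _ (by omega)
  rw [face1_apply R x0, ext_dd _ _ _ _ _ _ (by omega), ext_dd _ _ _ _ _ _ (by simp; omega),
    ext_dd _ _ _ _ _ _ (by omega)]
  have hi : dn R j (ext x0 x) (ext x0 y) (i + 1) = x i := by
    unfold dn
    rw [if_neg (by omega), if_neg (by omega), if_neg (by omega), Nat.add_sub_cancel, hxi]
  simp only [Fin.val_succ, hi, dd]
  have hy : ∀ l : ℕ, l < n + 1 →
      ext x0 (fun k => R.act (y k) (x i)) l = R.act (ext x0 y l) (x i) := fun l hl => by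
    rw [ext_lt _ _ _ hl, ext_lt _ _ _ hl]
  simp only [dn, ext_face1, hxi]
  rw [hy k (by omega), hy j (by omega)]
  by_cases h1 : (k : ℕ) < j
  · rw [if_pos (by omega), if_pos h1, if_pos h1, if_pos (by omega), R.distrib]
  by_cases h2 : (k : ℕ) = j
  · rw [if_pos (by omega), if_neg h1, if_neg h1, if_pos h2, if_pos h2, if_pos hij]
  by_cases h3 : (k : ℕ) = j + 1
  · rw [if_pos (by omega), if_neg h1, if_neg h1, if_neg h2, if_neg h2, if_pos h3, if_pos h3]
  by_cases h4 : (k : ℕ) < i + 1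
  · rw [if_pos (by omega), if_neg h1, if_neg h1, if_neg h2, if_neg h2, if_neg h3, if_neg h3,
      if_pos (by omega)]
  · rw [if_neg (by omega), if_neg (by omega), if_neg (by omega), if_neg (by omega), if_neg h1,
      if_neg h2, if_neg h3, if_neg (by omega)]
    congr 1; omega

theorem T5 (R : RackStr X) [Fintype X] (hh : Homog R) (x0 : X) {n : ℕ} (j : Fin (n + 1))
    (x : Fin (n + 1) → X) (i : Fin (n + 1)) (hij : (i : ℕ) ≤ j) :
    ∑ y : Fin (n + 1) → X, FreeAbelianGroup.of (dd R x0 j (face0 i x) y) =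
    ∑ y : Fin (n + 1) → X, FreeAbelianGroup.of (dd R x0 j (face1 R i x) y) := by
  choose s hs using exists_s1 R hh
  let t := tt (N := n + 1) i (fun _ => x i) (fun k w => s (ext x0 x k) w)
  refine sum_eq _ _ t (tt_inj _ _ _ fun y y' h => rfl) fun y => ?_
  congr 1
  funext k
  have hxi : ext x0 x i = x i := ext_lt _ _ _ (by omega)
  have hl : ∀ l, (i : ℕ) ≤ l → ext x0 (t y) l = ext x0 y l := fun l hl =>
      ext_tt x0 _ _ _ _ _ (by omega)
  simp only [dd, dn, ext_face0, ext_face1, hxi, hl j hij]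
  by_cases h0 : (k : ℕ) < i
  · rw [if_pos (by omega), if_pos (by omega), if_pos h0,
      ext_tt' x0 _ _ _ _ _ h0 (by omega), hs, if_pos (by omega)]
  · rw [hl k (by omega), if_neg h0, if_neg h0, if_neg (show ¬ (j : ℕ) < i by omega),
      if_neg (show ¬ (j : ℕ) < i by omega)]
    split_ifs <;> first | rfl | omega

theorem homotopy_gen (R : RackStr X) [Fintype X] (hh : Homog R) (x0 : X) {n : ℕ}
    (j : Fin (n + 1)) (x : Fin (n + 1) → X) :
    bdry R (n + 1) (DD R x0 j (n + 1) (n + 1) (FreeAbelianGroup.of x)) +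
      DD R x0 j n (n + 1) (bdry R n (FreeAbelianGroup.of x)) =
    (-1 : ℤ) ^ (j : ℕ) • (QQ R j (n + 1) (FreeAbelianGroup.of x) -
      QQ R (j + 1) (n + 1) (FreeAbelianGroup.of x)) := by
  have hb : bdry R (n + 1) (DD R x0 j (n + 1) (n + 1) (FreeAbelianGroup.of x)) =
      ∑ i : Fin (n + 2), ((-1 : ℤ) ^ ((i : ℕ) + 1)) •
        (∑ y : Fin (n + 1) → X, FreeAbelianGroup.of (face0 i (dd R x0 j x y)) -
          ∑ y : Fin (n + 1) → X, FreeAbelianGroup.of (face1 R i (dd R x0 j x y))) := by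
    simp only [DD, bdry, FreeAbelianGroup.lift_apply_of, map_sum]
    rw [Finset.sum_comm]
    refine Finset.sum_congr rfl fun i _ => ?_
    rw [← Finset.smul_sum, Finset.sum_sub_distrib]
  have hd : DD R x0 j n (n + 1) (bdry R n (FreeAbelianGroup.of x)) =
      ∑ i : Fin (n + 1), ((-1 : ℤ) ^ ((i : ℕ) + 1)) •
        (∑ y : Fin (n + 1) → X, FreeAbelianGroup.of (dd R x0 j (face0 i x) y) -
          ∑ y : Fin (n + 1) → X, FreeAbelianGroup.of (dd R x0 j (face1 R i x) y)) := by
    simp only [DD, bdry, FreeAbelianGroup.lift_apply_of, map_sum, map_zsmul, map_sub]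
  rw [hb, hd, Fin.sum_univ_succ, T1 R hh x0 j x 0 (by simp), sub_self, smul_zero, zero_add,
    ← Finset.sum_add_distrib, Finset.sum_eq_single j]
  · rw [T5 R hh x0 j x j le_rfl, sub_self, smul_zero, add_zero, ← T2b R hh x0 j x]
    simp only [T2a, QQ, FreeAbelianGroup.lift_apply_of, Fin.val_succ]
    rw [pow_succ, pow_succ]; simp
  · intro i _ hi
    rcases lt_or_gt_of_ne (fun h => hi (Fin.ext h) : (i : ℕ) ≠ j) with h | h
    · rw [T5 R hh x0 j x i h.le, T1 R hh x0 j x i.succ (by simp; omega)]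
      simp
    · rw [T4 R x0 j x i h]
      simp only [T3 R x0 j x _ i h, Fin.val_succ]
      rw [pow_succ _ ((i : ℕ) + 1), mul_neg_one, neg_smul, neg_add_cancel]
  · simp

theorem homotopy (R : RackStr X) [Fintype X] (hh : Homog R) (x0 : X) {n : ℕ}
    (j : Fin (n + 1)) (z : Ch X (n + 1)) :
    bdry R (n + 1) (DD R x0 j (n + 1) (n + 1) z) + DD R x0 j n (n + 1) (bdry R n z) =
    (-1 : ℤ) ^ (j : ℕ) • (QQ R j (n + 1) z - QQ R (j + 1) (n + 1) z) := by
  have : ((bdry R (n + 1)).comp (DD R x0 j (n + 1) (n + 1)) +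
      (DD R x0 j n (n + 1)).comp (bdry R n)) =
      (-1 : ℤ) ^ (j : ℕ) • (QQ R j (n + 1) - QQ R (j + 1) (n + 1)) := by
    ext x
    exact homotopy_gen R hh x0 j x
  exact DFunLike.congr_fun this z

theorem step (R : RackStr X) [Fintype X] (hh : Homog R) (x0 : X) {n : ℕ}
    (j : Fin (n + 1)) (z : Ch X (n + 1)) (hz : bdry R n z = 0) :
    QQ R (j + 1) (n + 1) z - QQ R j (n + 1) z ∈ (bdry R (n + 1)).range := by
  have h := homotopy R hh x0 j z
  rw [hz, map_zero, add_zero] at h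
  refine ⟨(-1 : ℤ) ^ ((j : ℕ) + 1) • DD R x0 j (n + 1) (n + 1) z, ?_⟩
  rw [map_zsmul, h, smul_smul, pow_succ, mul_right_comm, ← mul_pow]
  simp

theorem QQ_zero (R : RackStr X) [Fintype X] (n : ℕ) (z : Ch X n) :
    QQ R 0 n z = ((Fintype.card X : ℤ) ^ n) • z := by
  have : QQ R 0 n = ((Fintype.card X : ℤ) ^ n) • AddMonoidHom.id _ := by
    ext x
    have : ∀ y, qq R 0 x y = x := fun y => by funext i; simp [qq]
    simp only [QQ, FreeAbelianGroup.lift_apply_of, this]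
    simp
    norm_cast
  rw [this]; rfl

theorem QQ_top (R : RackStr X) [Fintype X] (n : ℕ) : QQ R n n = phi R n := by
  ext x
  have : ∀ y, qq R n x y = fun i => R.act (x i) (y i) := fun y => by funext i; simp [qq]
  simp only [QQ, FreeAbelianGroup.lift_apply_of, this, phi]

theorem part2 (R : RackStr X) [Fintype X] (hh : Homog R) (n : ℕ) (z : Ch X (n + 1))
    (hz : bdry R n z = 0) :
    phi R (n + 1) z - ((Fintype.card X : ℤ) ^ (n + 1)) • z ∈ (bdry R (n + 1)).range := by
  rcases isEmpty_or_nonempty X with hX | ⟨⟨x0⟩⟩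
  · have : IsEmpty (Fin (n + 1) → X) := ⟨fun f => hX.elim (f 0)⟩
    have hz0 : AddMonoidHom.id (Ch X (n + 1)) = 0 := by
      ext x
      exact this.elim x
    have : z = 0 := DFunLike.congr_fun hz0 z
    rw [this]
    simp
  · have key : ∀ j ≤ n + 1,
        QQ R j (n + 1) z - QQ R 0 (n + 1) z ∈ (bdry R (n + 1)).range := by
      intro j
      induction j with
      | zero => intro _; simp
      | succ j ih =>
        intro hj
        have h1 := step R hh x0 (⟨j, by omega⟩ : Fin (n + 1)) z hz
        have h2 := add_mem h1 (ih (by omega))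
        simpa using h2
    have := key (n + 1) le_rfl
    rwa [QQ_top, QQ_zero] at this

theorem mk_eq_iff (R : RackStr X) (a b : X) :
    (Quot.mk _ b : Orb R) = Quot.mk _ a ↔ orbRel R a b := by
  rw [eq_comm]
  exact Quot.eq

theorem nf_val (R : RackStr X) [Fintype X] (hh : Homog R) {a b : X} (h : orbRel R a b) :
    Nf R a b = Fintype.card X / Nat.card {x : X // (Quot.mk _ x : Orb R) = Quot.mk _ a} := by
  classical
  have e := Fintype.card_congr (Equiv.sigmaFiberEquiv (R.act a))
  rw [Fintype.card_sigma] at e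
  have e2 : ∀ b', Fintype.card {c // R.act a c = b'} =
      if (Quot.mk _ b' : Orb R) = Quot.mk _ a then Nf R a b else 0 := by
    intro b'
    rw [← Nat.card_eq_fintype_card]
    change Nf R a b' = _
    split_ifs with hb
    · rw [mk_eq_iff] at hb
      exact hh _ _ _ _ hb (hb.symm _ _) h
    · rw [mk_eq_iff] at hb
      exact nf_zero R hb
  simp only [e2] at e
  rw [← Finset.sum_filter, Finset.sum_const, smul_eq_mul] at e
  rw [← e, Nat.card_eq_fintype_card, Fintype.card_subtype, Nat.mul_div_cancel_left]
  exact Finset.card_pos.mpr ⟨a, by simp⟩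

theorem part1 (R : RackStr X) [Fintype X] (hh : Homog R) (n : ℕ) (c : Ch X n) :
    phi R n c = psi R n (projO R n c) := by
  classical
  have : phi R n = (psi R n).comp (projO R n) := by
    ext x
    have hr : psi R n (projO R n (FreeAbelianGroup.of x)) =
        (∏ i : Fin n, Fintype.card X /
          Nat.card {a : X // (Quot.mk _ a : Orb R) = Quot.mk _ (x i)}) •
        ∑ z : Fin n → X, if ∀ i, (Quot.mk _ (z i) : Orb R) = Quot.mk _ (x i)
          then FreeAbelianGroup.of z else 0 := by
      have h1 : projO R n (FreeAbelianGroup.of x) =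
        FreeAbelianGroup.of fun i => (Quot.mk _ (x i) : Orb R) :=
        FreeAbelianGroup.lift_apply_of _ _
      rw [h1]
      exact FreeAbelianGroup.lift_apply_of _ _
    rw [AddMonoidHom.comp_apply, hr]
    simp only [phi, FreeAbelianGroup.lift_apply_of]
    rw [← Finset.sum_fiberwise (s := Finset.univ)
      (g := fun y : Fin n → X => fun i => R.act (x i) (y i)), Finset.smul_sum]
    refine Finset.sum_congr rfl fun z _ => ?_
    rw [Finset.sum_congr rfl (g := fun _ => FreeAbelianGroup.of z)
      (fun y hy => by rw [(Finset.mem_filter.mp hy).2]), Finset.sum_const]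
    have hcard : (Finset.univ.filter fun y : Fin n → X => (fun i => R.act (x i) (y i)) = z).card =
        ∏ i, Nf R (x i) (z i) := by
      simp only [Nf]
      rw [← Nat.card_pi, ← Fintype.card_subtype, ← Nat.card_eq_fintype_card]
      refine Nat.card_congr (Equiv.trans (Equiv.subtypeEquivRight fun y => funext_iff)
        (Equiv.subtypePiEquivPi (p := fun i c => R.act (x i) c = z i)))
    rw [hcard]
    split_ifs with hz
    · congr 1
      exact Finset.prod_congr rfl fun i _ => nf_val R hh ((mk_eq_iff R _ _).mp (hz i))
    · push Not at hz
      obtain ⟨i, hi⟩ := hz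
      rw [Finset.prod_eq_zero (Finset.mem_univ i), zero_smul, smul_zero]
      exact nf_zero R fun h => hi ((mk_eq_iff R _ _).mpr h)
  rw [this]; rfl

end RackAux

/-- `φⁿ = ψ ∘ π`, and `ψ ∘ π` induces multiplication by `|X|ⁿ` on `H_n^R(X)`. -/
theorem stmt16 (R : RackStr X) [Fintype X] (hh : Homog R) :
    (∀ (n : ℕ) (c : Ch X n), phi R n c = psi R n (projO R n c)) ∧
    (∀ (n : ℕ) (z : Ch X (n + 1)), bdry R n z = 0 →
      phi R (n + 1) z - ((Fintype.card X : ℤ) ^ (n + 1)) • z ∈ (bdry R (n + 1)).range) := by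
  exact ⟨RackAux.part1 R hh, RackAux.part2 R hh⟩
end
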